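/- For every dimension d ≥ 1, there exists a constant c = c(d) > 0 such that for every finite non-empty set A ⊆ ℝ^d whose affine span has dimension d, there exist elements a_1, ..., a_c ∈ A satisfying |A + {a_1, ..., a_c}| ≥ (d+1)|A| - 5(d+1)^3. -/

import Mathlib

open Pointwise
open scoped Classical

namespace FewTranslates

open Finset

/-- The dimension of the affine span of a finite set. -/
noncomputable def affDim {V : Type*} [AddCommGroup V] [Module ℝ V] (A : Finset V) : ℕ :=
  Module.finrank ℝ (vectorSpan ℝ (A : Set V))

section Freiman

variable {V : Type*} [AddCommGroup V] [Module ℝ V]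

lemma vectorSpan_eq_span_image_sub {A : Finset V} {v : V} (hv : v ∈ A) :
    vectorSpan ℝ (A : Set V) = Submodule.span ℝ ((fun x => x - v) '' (A : Set V)) :=
  vectorSpan_eq_span_vsub_set_right ℝ (mem_coe.2 hv)

lemma vectorSpan_eq_span_erase {A : Finset V} {v : V} (hv : v ∈ A) :
    vectorSpan ℝ (A : Set V) =
      Submodule.span ℝ (((A.erase v).image (fun x => x - v) : Finset V) : Set V) := by
  rw [vectorSpan_eq_span_image_sub hv]
  apply le_antisymm
  · rw [Submodule.span_le]
    rintro _ ⟨x, hx, rfl⟩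
    by_cases h : x = v
    · simp [h]
    · exact Submodule.subset_span (by
        simp only [coe_image, coe_erase, Set.mem_image]
        exact ⟨x, ⟨hx, h⟩, rfl⟩)
  · apply Submodule.span_mono
    simp only [coe_image, coe_erase]
    exact Set.image_mono Set.sdiff_subset

lemma affDim_add_one_le_card {A : Finset V} (hA : A.Nonempty) : affDim A + 1 ≤ #A := by
  obtain ⟨v, hv⟩ := hA
  unfold affDim
  rw [vectorSpan_eq_span_erase hv]
  have h1 := finrank_span_finset_le_card (R := ℝ) ((A.erase v).image (fun x => x - v))
  have h2 := card_image_le (s := A.erase v) (f := fun x => x - v)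
  rw [card_erase_of_mem hv] at h2
  have := card_pos.2 ⟨v, hv⟩
  unfold Set.finrank at h1
  omega

/-- A finite set on which a linear functional is positive is spanned by those of its elements
that are not sums of two others. -/
lemma finrank_span_le_card_irreducible (T : Finset V) (φ : V →ₗ[ℝ] ℝ) (hφ : ∀ t ∈ T, 0 < φ t) :
    Module.finrank ℝ (Submodule.span ℝ (T : Set V)) ≤ #(T \ (T + T)) := by
  have key : ∀ n : ℕ, ∀ t ∈ T, #{s ∈ T | φ s < φ t} ≤ n →
      t ∈ Submodule.span ℝ ((T \ (T + T) : Finset V) : Set V) := by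
    intro n
    induction n with
    | zero =>
      intro t ht hn
      by_cases h : t ∈ T + T
      · obtain ⟨b, hb, c, hc, rfl⟩ := mem_add.1 h
        have : b ∈ ({s ∈ T | φ s < φ (b + c)} : Finset V) := by
          simp [hb, hφ c hc]
        have := card_pos.2 ⟨b, this⟩
        omega
      · exact Submodule.subset_span (mem_coe.2 (mem_sdiff.2 ⟨ht, h⟩))
    | succ n ih =>
      intro t ht hn
      by_cases h : t ∈ T + T
      · have aux : ∀ b ∈ T, φ b < φ t → b ∈ Submodule.span ℝ ((T \ (T + T) : Finset V) : Set V) := by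
          intro b hb hbt
          apply ih b hb
          have : ({s ∈ T | φ s < φ b} : Finset V) ⊂ {s ∈ T | φ s < φ t} := by
            rw [ssubset_iff_of_subset]
            · exact ⟨b, by simp [hb, hbt], by simp⟩
            · intro s hs
              simp only [mem_filter] at hs ⊢
              exact ⟨hs.1, hs.2.trans hbt⟩
          have := card_lt_card this
          omega
        obtain ⟨b, hb, c, hc, rfl⟩ := mem_add.1 h
        exact Submodule.add_mem _ (aux b hb (by simpa using hφ c hc))
          (aux c hc (by simpa using hφ b hb))
      · exact Submodule.subset_span (mem_coe.2 (mem_sdiff.2 ⟨ht, h⟩))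
  have hle : Submodule.span ℝ (T : Set V) ≤ Submodule.span ℝ ((T \ (T + T) : Finset V) : Set V) :=
    Submodule.span_le.2 fun t ht => key _ t ht le_rfl
  exact (Submodule.finrank_mono hle).trans (finrank_span_finset_le_card _)

lemma exists_dual_injOn (A : Finset V) : ∃ φ : V →ₗ[ℝ] ℝ, Set.InjOn φ A := by
  obtain ⟨f, hf⟩ := Module.exists_dual_forall_apply_ne_zero (K := ℝ)
    (fun p : {p : A × A // p.1 ≠ p.2} => (p.1.1 : V) - p.1.2)
    (fun p => by
      rw [sub_ne_zero]
      exact fun h => p.2 (Subtype.ext h))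
  refine ⟨f, fun a ha b hb hab => ?_⟩
  by_contra hne
  exact hf ⟨(⟨a, ha⟩, ⟨b, hb⟩), by simpa using hne⟩ (by simp [hab])

/-- **Freiman's lemma**. -/
theorem freiman_lemma (A : Finset V) (hA : A.Nonempty) :
    2 * (affDim A + 1) * #A ≤ 2 * #(A + A) + affDim A * (affDim A + 1) := by
  induction A using Finset.strongInduction with
  | H A ih =>
    obtain ⟨φ, hφ⟩ := exists_dual_injOn A
    obtain ⟨v, hv, hmin⟩ := exists_min_image A φ hA
    have hlt : ∀ a ∈ A.erase v, φ v < φ a := fun a ha =>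
      lt_of_le_of_ne (hmin a (mem_of_mem_erase ha))
        fun h => ne_of_mem_erase ha (hφ (mem_of_mem_erase ha) hv h.symm)
    have hcard : #(A.erase v) + 1 = #A := card_erase_add_one hv
    have hvv : v + v ∉ A.erase v + A.erase v := by
      rw [mem_add]
      rintro ⟨b, hb, c, hc, h⟩
      have := congrArg φ h
      simp only [map_add] at this
      linarith [hlt b hb, hlt c hc]
    have hsplit : ∀ R : Finset V, R ⊆ A.erase v →
        (∀ a ∈ R, a + v ∉ A.erase v + A.erase v) →
        #(A.erase v + A.erase v) + #R + 1 ≤ #(A + A) := by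
      intro R hR hRn
      have hdis : Disjoint (A.erase v + A.erase v) ((insert v R).image (· + v)) := by
        rw [disjoint_right]
        intro x hx
        obtain ⟨a, ha, rfl⟩ := mem_image.1 hx
        rcases mem_insert.1 ha with rfl | ha
        · exact hvv
        · exact hRn a ha
      have hsub : (A.erase v + A.erase v) ∪ (insert v R).image (· + v) ⊆ A + A := by
        apply union_subset (add_subset_add (erase_subset _ _) (erase_subset _ _))
        intro x hx
        obtain ⟨a, ha, rfl⟩ := mem_image.1 hx
        apply add_mem_add _ hv
        rcases mem_insert.1 ha with rfl | ha
        · exact hv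
        · exact mem_of_mem_erase (hR ha)
      have h1 := card_le_card hsub
      rw [card_union_of_disjoint hdis, card_image_of_injective _ (add_left_injective v),
        card_insert_of_notMem (fun h => by simpa using hR h)] at h1
      omega
    rcases (A.erase v).eq_empty_or_nonempty with h0 | hne
    · have h1 : #A = 1 := by rw [← hcard, h0]; rfl
      have := affDim_add_one_le_card hA
      have h2 : affDim A = 0 := by omega
      have h3 := card_pos.2 (hA.add hA)
      rw [h2, h1]
      omega
    have hI := ih _ (erase_ssubset hv) hne
    set d' := affDim (A.erase v) with hd'
    have hle : affDim A ≤ d' + 1 := by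
      have := finrank_vectorSpan_insert_le_set ℝ ((A.erase v : Finset V) : Set V) v
      rwa [← coe_insert, insert_erase hv] at this
    have hge : d' ≤ affDim A := by
      have : FiniteDimensional ℝ (vectorSpan ℝ (A : Set V)) :=
        finiteDimensional_vectorSpan_of_finite ℝ A.finite_toSet
      exact Submodule.finrank_mono (vectorSpan_mono ℝ (by simp))
    rcases hge.eq_or_lt with heq | hlt'
    · set T := (A.erase v).image (fun x => x - v) with hT
      have hspan : affDim A = Module.finrank ℝ (Submodule.span ℝ (T : Set V)) := by
        unfold affDim; rw [vectorSpan_eq_span_erase hv]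
      have hirr := finrank_span_le_card_irreducible T φ (by
        intro t ht
        obtain ⟨a, ha, rfl⟩ := mem_image.1 ht
        simpa using hlt a ha)
      have hs := hsplit ((T \ (T + T)).image (· + v)) (by
        intro x hx
        obtain ⟨t, ht, rfl⟩ := mem_image.1 hx
        obtain ⟨a, ha, rfl⟩ := mem_image.1 (mem_sdiff.1 ht).1
        simpa using ha) (by
        intro x hx hmem
        obtain ⟨t, ht, rfl⟩ := mem_image.1 hx
        obtain ⟨b, hb, c, hc, h⟩ := mem_add.1 hmem
        refine (mem_sdiff.1 ht).2 (mem_add.2 ⟨b - v, mem_image_of_mem _ hb, c - v,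
          mem_image_of_mem _ hc, ?_⟩)
        have : t = b + c - v - v := by rw [h]; abel
        rw [this]; abel)
      rw [card_image_of_injective _ (add_left_injective v)] at hs
      rw [← heq, ← hcard]
      nlinarith
    · have hs := hsplit (A.erase v) le_rfl (by
        intro a ha hmem
        obtain ⟨b, hb, c, hc, h⟩ := mem_add.1 hmem
        have hvs : vectorSpan ℝ (A : Set V) ≤ vectorSpan ℝ ((A.erase v : Finset V) : Set V) := by
          rw [vectorSpan_eq_span_image_sub hv, Submodule.span_le]
          have hv' : v - a ∈ vectorSpan ℝ ((A.erase v : Finset V) : Set V) := by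
            have : v - a = (b - a) + (c - a) := by
              rw [← sub_eq_zero, sub_eq_zero]
              have : v = b + c - a := by rw [h]; abel
              rw [this]; abel
            rw [this]
            exact Submodule.add_mem _ (vsub_mem_vectorSpan ℝ (mem_coe.2 hb) (mem_coe.2 ha))
              (vsub_mem_vectorSpan ℝ (mem_coe.2 hc) (mem_coe.2 ha))
          rintro _ ⟨x, hx, rfl⟩
          by_cases hxv : x = v
          · simp [hxv]
          · have : x - v = (x - a) - (v - a) := by abel
            simp only [this]
            exact Submodule.sub_mem _ (vsub_mem_vectorSpan ℝ
              (mem_coe.2 (mem_erase.2 ⟨hxv, hx⟩)) (mem_coe.2 ha)) hv'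
        have : FiniteDimensional ℝ (vectorSpan ℝ ((A.erase v : Finset V) : Set V)) :=
          finiteDimensional_vectorSpan_of_finite ℝ (finite_toSet _)
        exact absurd (Submodule.finrank_mono hvs) (not_le.2 hlt'))
      have heq : affDim A = d' + 1 := by omega
      rw [heq, ← hcard]
      nlinarith

end Freiman

section Doubling

variable {V : Type*} [AddCommGroup V]

lemma exists_card_add_sdiff_le (A : Finset V) (K E : ℕ)
    (h : ∀ X ⊆ A, #X ≤ K * E → #(A + X) < K * #A) :
    ∃ X ⊆ A, #X ≤ K * E ∧ ∀ a ∈ A, E * #((A + {a}) \ (A + X)) ≤ #A := by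
  by_contra! hc
  have key : ∀ j ≤ K * E, ∃ X ⊆ A, #X ≤ j ∧ j * #A ≤ E * #(A + X) := by
    intro j
    induction j with
    | zero => exact fun _ => ⟨∅, by simp⟩
    | succ j ih =>
      intro hj
      obtain ⟨X, hXA, hX, hjX⟩ := ih (by omega)
      obtain ⟨a, ha, hlt⟩ := hc X hXA (by omega)
      refine ⟨insert a X, insert_subset ha hXA, (card_insert_le _ _).trans (by omega), ?_⟩
      have h1 : A + insert a X = (A + X) ∪ ((A + {a}) \ (A + X)) := by
        rw [union_sdiff_self_eq_union, insert_eq, add_union, union_comm]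
      rw [h1, card_union_of_disjoint disjoint_sdiff]
      nlinarith
  obtain ⟨X, hXA, hX, hle⟩ := key _ le_rfl
  have := h X hXA hX
  rcases Nat.eq_zero_or_pos E with rfl | hE
  · obtain ⟨a, ha, hlt⟩ := hc X hXA hX
    omega
  · nlinarith

/-- If no bounded number of translates of `A` has a large union, then `A` has small doubling. -/
lemma exists_card_add_self_le (K : ℕ) : ∃ C c : ℕ, ∀ (V : Type) [AddCommGroup V] (A : Finset V),
    (∀ X ⊆ A, #X ≤ c → #(A + X) < K * #A) → #(A + A) ≤ C * #A := by
  set κ := 4 * K with hκ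
  refine ⟨8 * κ ^ 2 * K ^ 3, K * 2 + K * (2 * κ ^ 2), fun V _ A h => ?_⟩
  obtain ⟨X', hX'A, hX', hcov⟩ := exists_card_add_sdiff_le A K 2
    fun X hX hc => h X hX (by omega)
  obtain ⟨X, hXA, hX, hS⟩ := exists_card_add_sdiff_le A K (2 * κ ^ 2)
    fun X hX hc => h X hX (by omega)
  set S := A + X with hSdef
  have hScard : #S < K * #A := h X hXA (by omega)
  have hU : ∀ a ∈ A, ∃ x ∈ X', #A ≤ κ * #{u ∈ A | u + a - x ∈ A} := by
    intro a ha
    by_contra! hlt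
    have h1 := hcov a ha
    have h2 : (A + {a}) ⊆ ((A + {a}) \ (A + X')) ∪
        X'.biUnion fun x => ({u ∈ A | u + a - x ∈ A} : Finset V).image (· + a) := by
      intro s hs
      obtain ⟨u, hu, b, hb, rfl⟩ := mem_add.1 hs
      obtain rfl := mem_singleton.1 hb
      by_cases hm : u + b ∈ A + X'
      · obtain ⟨w, hw, x, hx, hwx⟩ := mem_add.1 hm
        refine mem_union_right _ (mem_biUnion.2 ⟨x, hx, mem_image_of_mem _ ?_⟩)
        simp [hu, ← hwx, hw]
      · exact mem_union_left _ (mem_sdiff.2 ⟨hs, hm⟩)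
    have h3 := (card_le_card h2).trans (card_union_le _ _)
    rw [card_add_singleton] at h3
    have h4 : κ * #(X'.biUnion fun x => ({u ∈ A | u + a - x ∈ A} : Finset V).image (· + a)) ≤
        #X' * #A := by
      calc _ ≤ κ * ∑ x ∈ X', #(({u ∈ A | u + a - x ∈ A} : Finset V).image (· + a)) := by
            gcongr; exact card_biUnion_le
        _ = ∑ x ∈ X', κ * #({u ∈ A | u + a - x ∈ A} : Finset V) := by
            rw [mul_sum]
            exact sum_congr rfl fun x _ => by
              rw [card_image_of_injective _ (add_left_injective a)]
        _ ≤ ∑ x ∈ X', #A := sum_le_sum fun x hx => (hlt x hx).le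
        _ = _ := by simp
    rcases X'.eq_empty_or_nonempty with rfl | ⟨x, hx⟩
    · simp at h3 h1
      have := card_pos.2 ⟨a, ha⟩
      omega
    · have h5 : κ * #(X'.biUnion fun x => ({u ∈ A | u + a - x ∈ A} : Finset V).image (· + a)) <
          #X' * #A := by
        calc _ ≤ κ * ∑ x ∈ X', #(({u ∈ A | u + a - x ∈ A} : Finset V).image (· + a)) := by
              gcongr; exact card_biUnion_le
          _ = ∑ x ∈ X', κ * #({u ∈ A | u + a - x ∈ A} : Finset V) := by
              rw [mul_sum]
              exact sum_congr rfl fun x _ => by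
                rw [card_image_of_injective _ (add_left_injective a)]
          _ < ∑ x ∈ X', #A := sum_lt_sum_of_nonempty ⟨x, hx⟩ fun x hx => hlt x hx
          _ = _ := by simp
      have h6 : 2 * #A ≤ #A + 2 * #(X'.biUnion fun x =>
        ({u ∈ A | u + a - x ∈ A} : Finset V).image (· + a)) := by omega
      have h7 : #X' * #A ≤ K * 2 * #A := Nat.mul_le_mul_right _ hX'
      nlinarith
  choose! x hxX hxU using hU
  set T : V → Finset (V × V × V × V × V) := fun s =>
    {t ∈ X' ×ˢ X' ×ˢ A ×ˢ A ×ˢ S | t.1 + t.2.1 + t.2.2.1 + t.2.2.2.1 - t.2.2.2.2 = s} with hT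
  have hTs : ∀ s ∈ A + A, #A * #A ≤ 2 * κ ^ 2 * #(T s) := by
    intro s hs
    obtain ⟨a, ha, b, hb, rfl⟩ := mem_add.1 hs
    set Ua : Finset V := {u ∈ A | u + a - x a ∈ A} with hUa
    set Ub : Finset V := {u ∈ A | u + b - x b ∈ A} with hUb
    have hbad : 2 * κ ^ 2 * #{p ∈ Ua ×ˢ Ub | p.1 + p.2 ∉ S} ≤ #A * #A := by
      have h1 : #{p ∈ Ua ×ˢ Ub | p.1 + p.2 ∉ S} ≤ ∑ u ∈ A, #((A + {u}) \ S) := by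
        rw [← card_sigma]
        refine card_le_card_of_injOn (fun p => ⟨p.1, p.1 + p.2⟩) ?_ ?_
        · intro p hp
          simp only [coe_filter, Set.mem_ofPred_eq, mem_product, hUa, hUb, mem_filter] at hp
          simp only [coe_sigma, Set.mem_sigma_iff, mem_coe, mem_sdiff]
          refine ⟨hp.1.1.1, ?_, hp.2⟩
          rw [add_comm p.1 p.2]
          exact add_mem_add hp.1.2.1 (mem_singleton_self _)
        · intro p _ q _ hpq
          simp only [Sigma.mk.injEq, heq_eq_eq] at hpq
          refine Prod.ext hpq.1 ?_
          have := hpq.2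
          rwa [hpq.1, add_right_inj] at this
      calc _ ≤ 2 * κ ^ 2 * ∑ u ∈ A, #((A + {u}) \ S) := by gcongr
        _ = ∑ u ∈ A, 2 * κ ^ 2 * #((A + {u}) \ S) := mul_sum _ _ _
        _ ≤ ∑ u ∈ A, #A := sum_le_sum hS
        _ = _ := by simp
    have hgood : #{p ∈ Ua ×ˢ Ub | p.1 + p.2 ∈ S} ≤ #(T (a + b)) := by
      refine card_le_card_of_injOn
        (fun p => (x a, x b, p.1 + a - x a, p.2 + b - x b, p.1 + p.2)) ?_ ?_
      · intro p hp
        simp only [coe_filter, Set.mem_ofPred_eq, mem_product, hUa, hUb, mem_filter] at hp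
        simp only [hT, coe_filter, Set.mem_ofPred_eq, mem_product]
        exact ⟨⟨hxX a ha, hxX b hb, hp.1.1.2, hp.1.2.2, hp.2⟩, by abel⟩
      · intro p _ q _ hpq
        simp only [Prod.mk.injEq, true_and, sub_left_inj, add_left_inj] at hpq
        exact Prod.ext hpq.1 hpq.2.1
    have hsum := card_filter_add_card_filter_not (s := Ua ×ˢ Ub) (fun p => p.1 + p.2 ∈ S)
    rw [card_product] at hsum
    have ha' := hxU a ha
    have hb' := hxU b hb
    have hm : #A * #A ≤ (κ * #Ua) * (κ * #Ub) := Nat.mul_le_mul ha' hb'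
    have hm' : (κ * #Ua) * (κ * #Ub) = κ ^ 2 * (#Ua * #Ub) := by ring
    rw [hm', ← hsum] at hm
    have := Nat.mul_le_mul_left (2 * κ ^ 2) hgood
    nlinarith
  have hdisj : ∑ s ∈ A + A, #(T s) ≤ #X' * (#X' * (#A * (#A * #S))) := by
    rw [← card_biUnion]
    · refine (card_le_card (t := X' ×ˢ X' ×ˢ A ×ˢ A ×ˢ S) ?_).trans (by simp)
      exact biUnion_subset.2 fun s _ => filter_subset _ _
    · intro s _ s' _ hne
      rw [Function.onFun, disjoint_left]
      intro t ht ht'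
      exact hne ((mem_filter.1 ht).2.symm.trans (mem_filter.1 ht').2)
  have hfin : #(A + A) * (#A * #A) ≤ (8 * κ ^ 2 * K ^ 3 * #A) * (#A * #A) := by
    calc #(A + A) * (#A * #A) = ∑ s ∈ A + A, #A * #A := by simp
      _ ≤ ∑ s ∈ A + A, 2 * κ ^ 2 * #(T s) := sum_le_sum hTs
      _ = 2 * κ ^ 2 * ∑ s ∈ A + A, #(T s) := (mul_sum _ _ _).symm
      _ ≤ 2 * κ ^ 2 * (#X' * (#X' * (#A * (#A * #S)))) := by gcongr
      _ ≤ 2 * κ ^ 2 * ((K * 2) * ((K * 2) * (#A * (#A * (K * #A))))) := by gcongr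
      _ = _ := by ring
  rcases A.eq_empty_or_nonempty with rfl | hne
  · simp
  · exact le_of_mul_le_mul_right hfin (Nat.mul_pos hne.card_pos hne.card_pos)

end Doubling

section RichLine

lemma card_nsmul_sub_nsmul_le {V : Type*} [AddCommGroup V] {A : Finset V} {C : ℕ}
    (hA : A.Nonempty) (h : #(A + A) ≤ C * #A) (m n : ℕ) :
    #(m • A - n • A) ≤ C ^ (m + n) * #A := by
  have h1 := pluennecke_ruzsa_inequality_nsmul_sub_nsmul_add hA A m n
  have hpos : (0 : ℚ≥0) < #A := by exact_mod_cast hA.card_pos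
  have h2 : (#(A + A) / #A : ℚ≥0) ≤ C := by
    rw [div_le_iff₀ hpos]
    exact_mod_cast h
  have h3 : (#(m • A - n • A) : ℚ≥0) ≤ C ^ (m + n) * #A := h1.trans (by gcongr)
  exact_mod_cast h3

/-- A large set of small doubling has many points on some line. -/
lemma exists_rich_line_of_card_add_self_le (C R : ℕ) :
    ∃ N : ℕ, ∀ (V : Type) [AddCommGroup V] [Module ℝ V] (A : Finset V), N < #A →
    #(A + A) ≤ C * #A → ∃ v : V, v ≠ 0 ∧ ∃ a ∈ A,
      R ≤ #{x ∈ A | x - a ∈ Submodule.span ℝ {v}} := by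
  set L := R * C ^ 5 + 1 with hL
  set Q := (C + 1) ^ (L + 1) with hQ
  refine ⟨Q ^ L, fun V _ _ A hN hC => ?_⟩
  have hA : A.Nonempty := card_pos.1 (by omega)
  have hcov : ∀ i : Fin L, ∃ F : Finset V, #F ≤ Q ∧
      A.image (fun a => (i : ℕ) • a) ⊆ F + (A - A) := by
    intro i
    have hsub : A.image (fun a => (i : ℕ) • a) + A ⊆ ((i : ℕ) + 1) • A := by
      rw [succ_nsmul]
      apply add_subset_add_right
      intro x hx
      obtain ⟨a, ha, rfl⟩ := mem_image.1 hx
      exact nsmul_mem_nsmul ha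
    have hcard : #(A.image (fun a => (i : ℕ) • a) + A) ≤ Q * #A := by
      have h1 := card_nsmul_sub_nsmul_le hA hC ((i : ℕ) + 1) 0
      rw [zero_nsmul, sub_zero, add_zero] at h1
      refine (card_le_card hsub).trans (h1.trans ?_)
      gcongr
      calc C ^ ((i : ℕ) + 1) ≤ (C + 1) ^ ((i : ℕ) + 1) := by gcongr; omega
        _ ≤ _ := Nat.pow_le_pow_right (by omega) (by omega)
    obtain ⟨F, -, hF, hcov⟩ := ruzsa_covering_add (K := (Q : ℝ)) hA (by exact_mod_cast hcard)
    exact ⟨F, by exact_mod_cast hF, hcov⟩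
  choose F hFQ hF using hcov
  have hcol : ∀ a ∈ A, ∀ i : Fin L, ∃ x ∈ F i, (i : ℕ) • a - x ∈ A - A := by
    intro a ha i
    obtain ⟨x, hx, y, hy, hxy⟩ := mem_add.1 (hF i (mem_image_of_mem _ ha))
    exact ⟨x, hx, by simpa [← hxy] using hy⟩
  choose! g hgF hg using hcol
  obtain ⟨a, ha, b, hb, hne, hab⟩ := exists_ne_map_eq_of_card_lt_of_maps_to
    (t := Fintype.piFinset F) (f := g)
    (by
      rw [Fintype.card_piFinset]
      refine lt_of_le_of_lt ?_ hN
      refine (prod_le_pow_card _ _ Q fun i _ => hFQ i).trans (by simp))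
    (fun a ha => by
      simp only [mem_coe, Fintype.mem_piFinset]
      exact fun i => hgF a ha i)
  set v := a - b with hv
  have hv0 : v ≠ 0 := sub_ne_zero.2 hne
  refine ⟨v, hv0, ?_⟩
  by_contra! hlt
  set B := (range L).image (fun i => i • v) with hB
  have hAB : #(A + B) ≤ C ^ 5 * #A := by
    refine (card_le_card ?_).trans (card_nsmul_sub_nsmul_le hA hC 3 2)
    have : 3 • A - 2 • A = A + ((A - A) - (A - A)) := by
      have h3 : 3 • A = A + A + A := by rw [show 3 = 2 + 1 from rfl, succ_nsmul, two_nsmul]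
      rw [h3, two_nsmul]
      simp only [sub_eq_add_neg, neg_add_rev, neg_neg]
      ac_rfl
    rw [this]
    apply add_subset_add_left
    intro x hx
    obtain ⟨i, hi, rfl⟩ := mem_image.1 hx
    have hi' := mem_range.1 hi
    have h1 := hg a ha ⟨i, hi'⟩
    have h2 := hg b hb ⟨i, hi'⟩
    rw [← hab] at h2
    have : i • v = (i • a - g a ⟨i, hi'⟩) - (i • b - g a ⟨i, hi'⟩) := by
      rw [hv, nsmul_sub]; abel
    rw [this]
    exact sub_mem_sub h1 h2
  set π := (Submodule.span ℝ {v}).mkQ with hπ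
  have hfib : #A ≤ R * #(A.image π) := by
    refine card_le_mul_card_image A R fun p hp => ?_
    obtain ⟨a, ha, rfl⟩ := mem_image.1 hp
    refine le_trans (card_le_card fun x hx => ?_) (hlt a ha).le
    simp only [mem_filter] at hx ⊢
    exact ⟨hx.1, (Submodule.Quotient.eq _).1 hx.2⟩
  have hbig : L * #(A.image π) ≤ #(A + B) := by
    refine mul_card_image_le_card_of_maps_to (f := π) ?_ L ?_
    · intro x hx
      obtain ⟨y, hy, z, hz, rfl⟩ := mem_add.1 hx
      obtain ⟨i, -, rfl⟩ := mem_image.1 hz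
      refine mem_coe.2 (mem_image.2 ⟨y, hy, ?_⟩)
      rw [map_add, map_nsmul, hπ, Submodule.mkQ_apply, Submodule.mkQ_apply,
        (Submodule.Quotient.mk_eq_zero _).2 (Submodule.mem_span_singleton_self v)]
      simp
    · intro p hp
      obtain ⟨y, hy, rfl⟩ := mem_image.1 hp
      have : L = #((range L).image (fun i => y + i • v)) := by
        rw [card_image_of_injective, card_range]
        intro i j hij
        have := add_left_cancel hij
        rw [← Nat.cast_smul_eq_nsmul ℝ, ← Nat.cast_smul_eq_nsmul ℝ j] at this
        exact_mod_cast smul_left_injective ℝ hv0 this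
      rw [this]
      refine card_le_card fun x hx => ?_
      obtain ⟨i, hi, rfl⟩ := mem_image.1 hx
      refine mem_filter.2 ⟨add_mem_add hy (mem_image_of_mem _ hi), ?_⟩
      rw [map_add, map_nsmul, hπ, Submodule.mkQ_apply, Submodule.mkQ_apply,
        (Submodule.Quotient.mk_eq_zero _).2 (Submodule.mem_span_singleton_self v)]
      simp
  have hpos := hA.card_pos
  have h1 : L * #A ≤ (R * C ^ 5) * #A := by
    calc L * #A ≤ L * (R * #(A.image π)) := by gcongr
      _ = R * (L * #(A.image π)) := by ring
      _ ≤ R * (C ^ 5 * #A) := Nat.mul_le_mul_left _ (hbig.trans hAB)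
      _ = _ := by ring
  have := le_of_mul_le_mul_right h1 hpos
  omega

end RichLine

section Line

variable {V : Type*} [AddCommGroup V]

/-- Adding a translate by `w` enlarges each residue class modulo `w`. -/
lemma card_add_card_residues_le (f : V →+ ℝ) (A : Finset V) {w : V} (hw : 0 < f w) :
    #A + #(A.image (QuotientAddGroup.mk : V → V ⧸ AddSubgroup.zmultiples w)) ≤
      #(A ∪ A.image (· + w)) := by
  have h1 : #(A.image (QuotientAddGroup.mk : V → V ⧸ AddSubgroup.zmultiples w)) ≤
      #(A.image (· + w) \ A) := by
    refine (card_le_card fun c hc => ?_).trans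
      (card_image_le (f := (QuotientAddGroup.mk : V → V ⧸ AddSubgroup.zmultiples w)))
    obtain ⟨a, ha, rfl⟩ := mem_image.1 hc
    obtain ⟨b, hb, hmax⟩ := exists_max_image
      {b ∈ A | (QuotientAddGroup.mk b : V ⧸ AddSubgroup.zmultiples w) = QuotientAddGroup.mk a} f
      ⟨a, by simp [ha]⟩
    obtain ⟨hbA, hba⟩ := mem_filter.1 hb
    have hbw : (QuotientAddGroup.mk (b + w) : V ⧸ AddSubgroup.zmultiples w) =
        QuotientAddGroup.mk a := by
      rw [← hba, QuotientAddGroup.mk_add_of_mem]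
      exact AddSubgroup.mem_zmultiples w
    refine mem_image.2 ⟨b + w, mem_sdiff.2 ⟨mem_image_of_mem _ hbA, fun h => ?_⟩, hbw⟩
    have := hmax _ (mem_filter.2 ⟨h, hbw⟩)
    rw [map_add] at this
    linarith
  rw [← union_sdiff_self_eq_union, card_union_of_disjoint disjoint_sdiff]
  omega

lemma card_mul_add_min_le_sum_card_add_triple (f : V →+ ℝ) (A B : Finset V) {x₀ x₁ : V}
    (hx : f x₀ < f x₁)
    (hB : ∀ x ∈ B, ∀ y ∈ B, x - y ∈ AddSubgroup.zmultiples (x₁ - x₀) → x = y) :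
    #B * (#A + min #A #B) ≤ ∑ x ∈ B, #(A + {x₀, x₁, x}) := by
  set w := x₁ - x₀ with hw
  set ρ : V → V ⧸ AddSubgroup.zmultiples w := QuotientAddGroup.mk with hρ
  have hfw : 0 < f w := by rw [hw, map_sub]; linarith
  set r := #(A.image ρ) with hr
  have hrn : r ≤ #A := card_image_le
  have hpair : #A + r ≤ #(A + {x₀, x₁}) := by
    refine (card_add_card_residues_le f A hfw).trans ?_
    rw [← card_image_of_injective _ (add_left_injective x₀)]
    refine card_le_card fun y hy => ?_
    obtain ⟨z, hz, rfl⟩ := mem_image.1 hy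
    rcases mem_union.1 hz with hz | hz
    · exact add_mem_add hz (by simp)
    · obtain ⟨a, ha, rfl⟩ := mem_image.1 hz
      exact mem_add.2 ⟨a, ha, x₁, by simp, by rw [hw]; abel⟩
  set R := (A.image (· + x₀)).image ρ with hR
  have hRr : #R = r := by
    rw [hR, image_image, hr]
    have : (ρ ∘ fun x => x + x₀) = (fun c => c + ρ x₀) ∘ ρ := by
      ext x; simp [hρ]
    rw [this, ← image_image, card_image_of_injective _ (add_left_injective _)]
  have hpairR : ∀ s ∈ A + {x₀, x₁}, ρ s ∈ R := by
    intro s hs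
    obtain ⟨a, ha, y, hy, rfl⟩ := mem_add.1 hs
    refine mem_image.2 ⟨a + x₀, mem_image_of_mem _ ha, ?_⟩
    simp only [mem_insert, mem_singleton] at hy
    rcases hy with rfl | rfl
    · rfl
    · rw [hρ, QuotientAddGroup.eq, hw]
      convert AddSubgroup.mem_zmultiples (y - x₀) using 1
      abel
  have hone : ∀ x ∈ B, #A + r + #{a ∈ A | ρ (a + x) ∉ R} ≤ #(A + {x₀, x₁, x}) := by
    intro x _
    have hd : Disjoint (A + {x₀, x₁}) (({a ∈ A | ρ (a + x) ∉ R} : Finset V).image (· + x)) := by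
      rw [disjoint_left]
      intro s hs hs'
      obtain ⟨a, ha, rfl⟩ := mem_image.1 hs'
      exact (mem_filter.1 ha).2 (hpairR _ hs)
    have hc := card_union_of_disjoint hd
    rw [card_image_of_injective _ (add_left_injective x)] at hc
    refine le_trans (by omega) (hc.symm.le.trans (card_le_card ?_))
    refine union_subset (add_subset_add_left (by intro y; simp; tauto)) fun s hs => ?_
    obtain ⟨a, ha, rfl⟩ := mem_image.1 hs
    exact add_mem_add (mem_filter.1 ha).1 (by simp)
  have hnew : ∀ a ∈ A, #B ≤ r + #{x ∈ B | ρ (a + x) ∉ R} := by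
    intro a _
    rw [← card_filter_add_card_filter_not (s := B) (fun x => ρ (a + x) ∈ R), ← hRr]
    refine Nat.add_le_add_right (card_le_card_of_injOn (fun x => ρ (a + x)) ?_ ?_) _
    · intro x hx
      exact (mem_filter.1 hx).2
    · intro x hx y hy hxy
      refine hB x (mem_filter.1 hx).1 y (mem_filter.1 hy).1 ?_
      have := (QuotientAddGroup.eq.1 hxy.symm)
      convert this using 1
      abel
  have hswap : ∑ x ∈ B, #{a ∈ A | ρ (a + x) ∉ R} = ∑ a ∈ A, #{x ∈ B | ρ (a + x) ∉ R} := by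
    simp only [card_filter]
    exact sum_comm
  have h1 : #B * (#A + r) + ∑ a ∈ A, #{x ∈ B | ρ (a + x) ∉ R} ≤
      ∑ x ∈ B, #(A + {x₀, x₁, x}) := by
    rw [← hswap]
    calc _ = ∑ x ∈ B, (#A + r + #{a ∈ A | ρ (a + x) ∉ R}) := by
          rw [sum_add_distrib, sum_const, smul_eq_mul]
      _ ≤ _ := sum_le_sum hone
  have h2 : #A * #B ≤ #A * r + ∑ a ∈ A, #{x ∈ B | ρ (a + x) ∉ R} := by
    calc #A * #B = ∑ a ∈ A, #B := by simp
      _ ≤ ∑ a ∈ A, (r + #{x ∈ B | ρ (a + x) ∉ R}) := sum_le_sum hnew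
      _ = _ := by simp [sum_add_distrib]
  refine le_trans ?_ h1
  generalize (∑ a ∈ A, #{x ∈ B | ρ (a + x) ∉ R}) = t at h2
  clear_value r
  generalize #A = n at *
  generalize #B = b at *
  rcases le_total r b with hrb | hrb
  · rcases le_total n b with hnb | hnb
    · rw [min_eq_left hnb]
      obtain ⟨k, rfl⟩ := Nat.exists_eq_add_of_le hnb
      nlinarith [Nat.zero_le (r * k)]
    · rw [min_eq_right hnb]
      obtain ⟨k, rfl⟩ := Nat.exists_eq_add_of_le hnb
      obtain ⟨l, rfl⟩ := Nat.exists_eq_add_of_le hrb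
      nlinarith [Nat.zero_le (k * l)]
  · have : min n b ≤ r := (min_le_right _ _).trans hrb
    nlinarith

/-- The covering step: if every `q` is served by a fixed proportion of `B`, then boundedly many
elements of `B` serve nearly every `q`. -/
lemma exists_small_cover {α ι : Type*} (K : ℕ) (Q : Finset ι) (B : Finset α) (good : ι → α → Prop)
    (hgood : ∀ q ∈ Q, #B ≤ (K + 1) * #{x ∈ B | good q x}) (hB : B.Nonempty) (m : ℕ) :
    ∃ X ⊆ B, #X ≤ m ∧ (K + 1) ^ m * #{q ∈ Q | ∀ x ∈ X, ¬ good q x} ≤ K ^ m * #Q := by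
  induction m with
  | zero => exact ⟨∅, by simp⟩
  | succ m ih =>
    obtain ⟨X, hXB, hX, hle⟩ := ih
    set U : Finset ι := {q ∈ Q | ∀ x ∈ X, ¬ good q x} with hU
    have h1 : ∑ x ∈ B, #U ≤ ∑ x ∈ B, (K + 1) * #{q ∈ U | good q x} := by
      rw [← mul_sum]
      have : ∑ x ∈ B, #{q ∈ U | good q x} = ∑ q ∈ U, #{x ∈ B | good q x} := by
        simp only [card_filter]
        exact sum_comm
      rw [this, mul_sum, sum_const, smul_eq_mul, mul_comm, ← smul_eq_mul, ← sum_const]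
      exact sum_le_sum fun q hq => hgood q (mem_filter.1 hq).1
    obtain ⟨x, hxB, hx⟩ := exists_le_of_sum_le hB h1
    refine ⟨insert x X, insert_subset hxB hXB, (card_insert_le _ _).trans (by omega), ?_⟩
    have h2 : ({q ∈ Q | ∀ y ∈ insert x X, ¬ good q y} : Finset ι) = {q ∈ U | ¬ good q x} := by
      ext q
      simp only [hU, mem_filter, mem_insert, forall_eq_or_imp]
      tauto
    have h3 := card_filter_add_card_filter_not (s := U) (fun q => good q x)
    rw [h2]
    have h4 : (K + 1) * #{q ∈ U | ¬ good q x} ≤ K * #U := by nlinarith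
    calc (K + 1) ^ (m + 1) * #{q ∈ U | ¬ good q x}
        = (K + 1) ^ m * ((K + 1) * #{q ∈ U | ¬ good q x}) := by ring
      _ ≤ (K + 1) ^ m * (K * #U) := by gcongr
      _ = K * ((K + 1) ^ m * #U) := by ring
      _ ≤ K * (K ^ m * #Q) := by gcongr
      _ = _ := by ring

lemma exists_mul_pow_le_pow_succ (K N : ℕ) : ∃ m : ℕ, N * K ^ m ≤ (K + 1) ^ m := by
  rcases Nat.eq_zero_or_pos K with rfl | hK
  · exact ⟨1, by simp⟩
  refine ⟨N * K, ?_⟩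
  have h := one_add_mul_le_pow (a := (1 / K : ℝ)) (by have : (0:ℝ) ≤ 1 / K := by positivity
                                                      linarith) (N * K)
  have hK' : (0 : ℝ) < K := by exact_mod_cast hK
  have h1 : (N : ℝ) ≤ (1 + 1 / K) ^ (N * K) := by
    refine le_trans ?_ h
    push_cast
    field_simp
    linarith
  have h2 : (N : ℝ) * K ^ (N * K) ≤ (K + 1) ^ (N * K) := by
    calc (N : ℝ) * K ^ (N * K) ≤ (1 + 1 / K) ^ (N * K) * K ^ (N * K) := by gcongr
      _ = _ := by rw [← mul_pow]; congr 1; field_simp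
  exact_mod_cast h2

/-- On a set where `f` is injective, extremal points of `f` witness the hypotheses of
`card_mul_add_min_le_sum_card_add_triple`. -/
lemma exists_extremal_pair (f : V →+ ℝ) (B : Finset V) (hB : Set.InjOn f B) (h2 : 2 ≤ #B) :
    ∃ x₀ ∈ B, ∃ x₁ ∈ B, ∀ A : Finset V,
      (#B - 1) * (#A + min #A (#B - 1)) ≤ ∑ x ∈ B.erase x₁, #(A + {x₀, x₁, x}) := by
  have hne : B.Nonempty := card_pos.1 (by omega)
  obtain ⟨x₀, hx₀, hmin⟩ := exists_min_image B f hne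
  obtain ⟨x₁, hx₁, hmax⟩ := exists_max_image B f hne
  have hlt : f x₀ < f x₁ := by
    refine lt_of_le_of_ne (hmin _ hx₁) fun h => ?_
    have : #B ≤ 1 := card_le_one.2 fun a ha b hb => hB ha hb
      (le_antisymm ((hmax a ha).trans (h.symm.le.trans (hmin b hb)))
        ((hmax b hb).trans (h.symm.le.trans (hmin a ha))))
    omega
  refine ⟨x₀, hx₀, x₁, hx₁, fun A => ?_⟩
  rw [← card_erase_of_mem hx₁]
  refine card_mul_add_min_le_sum_card_add_triple f A _ hlt fun x hx y hy hxy => ?_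
  obtain ⟨hx1, hxB⟩ := mem_erase.1 hx
  obtain ⟨hy1, hyB⟩ := mem_erase.1 hy
  obtain ⟨k, hk⟩ := AddSubgroup.mem_zmultiples_iff.1 hxy
  have hfk : (k : ℝ) * (f x₁ - f x₀) = f x - f y := by
    rw [← map_sub, ← map_sub, ← hk, map_zsmul, zsmul_eq_mul]
  have hfx : f x < f x₁ := lt_of_le_of_ne (hmax x hxB) fun h => hx1 (hB hxB hx₁ h)
  have hfy : f y < f x₁ := lt_of_le_of_ne (hmax y hyB) fun h => hy1 (hB hyB hx₁ h)
  have := hmin x hxB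
  have := hmin y hyB
  have hk1 : (k : ℝ) < 1 := by nlinarith
  have hk2 : (-1 : ℝ) < k := by nlinarith
  have hk0 : k = 0 := by
    have : k < 1 := by exact_mod_cast hk1
    have : -1 < k := by exact_mod_cast hk2
    omega
  rw [hk0, zero_zsmul] at hk
  exact sub_eq_zero.1 hk.symm

lemma exists_exact_translates {ι : Type*} (f : V →+ ℝ) (B : Finset V) (hB : Set.InjOn f B)
    (hne : B.Nonempty) (Q : Finset ι) (S : ι → Finset V) :
    ∃ X ⊆ B, #X ≤ #Q + 2 ∧ ∀ q ∈ Q, #(S q) + min #(S q) #B ≤ #(S q + X) + 1 := by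
  rcases Nat.lt_or_ge #B 2 with h | h
  · refine ⟨B, Subset.rfl, by omega, fun q _ => ?_⟩
    have h1 : #B = 1 := by have := hne.card_pos; omega
    obtain ⟨x, rfl⟩ := card_eq_one.1 h1
    rw [card_add_singleton, h1]
    have := min_le_right #(S q) 1
    omega
  obtain ⟨x₀, hx₀, x₁, hx₁, hsum⟩ := exists_extremal_pair f B hB h
  have hne' : (B.erase x₁).Nonempty := card_pos.1 (by rw [card_erase_of_mem hx₁]; omega)
  have : ∀ q, ∃ x ∈ B, #(S q) + min #(S q) (#B - 1) ≤ #(S q + {x₀, x₁, x}) := by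
    intro q
    have h1 := hsum (S q)
    rw [← card_erase_of_mem hx₁, ← smul_eq_mul, ← sum_const] at h1
    obtain ⟨x, hx, hle⟩ := exists_le_of_sum_le hne' h1
    exact ⟨x, mem_of_mem_erase hx, by rwa [card_erase_of_mem hx₁] at hle⟩
  choose x hxB hx using this
  refine ⟨{x₀, x₁} ∪ Q.image x, ?_, ?_, fun q hq => ?_⟩
  · refine union_subset (by simp [insert_subset_iff, hx₀, hx₁]) fun y hy => ?_
    obtain ⟨q, -, rfl⟩ := mem_image.1 hy
    exact hxB q
  · refine (card_union_le _ _).trans ?_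
    have := card_le_two (a := x₀) (b := x₁)
    have := card_image_le (s := Q) (f := x)
    omega
  · have h1 : #(S q + {x₀, x₁, x q}) ≤ #(S q + ({x₀, x₁} ∪ Q.image x)) := by
      refine card_le_card (add_subset_add_left ?_)
      intro y hy
      simp only [mem_insert, mem_singleton] at hy
      simp only [mem_union, mem_insert, mem_singleton, mem_image]
      rcases hy with rfl | rfl | rfl
      · simp
      · simp
      · exact Or.inr ⟨q, hq, rfl⟩
    have := hx q
    omega

lemma exists_approx_translates (H N : ℕ) : ∃ m : ℕ, ∀ {V ι : Type} [AddCommGroup V]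
    (f : V →+ ℝ) (B : Finset V) (_ : Set.InjOn f B) (_ : B.Nonempty) (Q : Finset ι)
    (S : ι → Finset V) (h : ℕ) (_ : 1 ≤ h) (_ : ∀ q ∈ Q, #(S q) ≤ 2 * H * h),
    ∃ X ⊆ B, #X ≤ m ∧
      N * #{q ∈ Q | ¬ #(S q) + min #(S q) #B ≤ #(S q + X) + h} ≤ #Q := by
  obtain ⟨m, hm⟩ := exists_mul_pow_le_pow_succ (6 * H) N
  refine ⟨m + 2, fun {V ι} _ f B hB hne Q S h hh hS => ?_⟩
  rcases Nat.lt_or_ge #B 2 with h2 | h2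
  · refine ⟨B, Subset.rfl, by omega, ?_⟩
    have h1 : #B = 1 := by have := hne.card_pos; omega
    obtain ⟨x, rfl⟩ := card_eq_one.1 h1
    rw [filter_false_of_mem, card_empty, mul_zero]
    · exact Nat.zero_le _
    intro q _
    rw [not_not, card_add_singleton, h1]
    have := min_le_right #(S q) 1
    omega
  obtain ⟨x₀, hx₀, x₁, hx₁, hsum⟩ := exists_extremal_pair f B hB h2
  have hb : #(B.erase x₁) = #B - 1 := card_erase_of_mem hx₁
  have hne' : (B.erase x₁).Nonempty := card_pos.1 (by omega)
  obtain ⟨X, hXB, hX, hle⟩ := exists_small_cover (6 * H) Q (B.erase x₁)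
    (fun q x => #(S q) + min #(S q) #B ≤ #(S q + {x₀, x₁, x}) + h) (fun q hq => by
      set n := #(S q) with hn
      set T := n + min n (#B - 1) with hT
      set G : Finset V := {x ∈ B.erase x₁ | n + min n #B ≤ #(S q + {x₀, x₁, x}) + h} with hG
      have hs := hsum (S q)
      rw [← hb] at hs
      have h3 : ∀ x ∈ B.erase x₁, #(S q + {x₀, x₁, x}) + h ≤ T + if x ∈ G then 3 * n + h else 0 := by
        intro x hx
        split_ifs with hxG
        · have h4 : #(S q + {x₀, x₁, x}) ≤ n * 3 := card_add_le.trans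
            (Nat.mul_le_mul_left _ card_le_three)
          omega
        · have : ¬ (n + min n #B ≤ #(S q + {x₀, x₁, x}) + h) := fun hc =>
            hxG (mem_filter.2 ⟨hx, hc⟩)
          have h5 : min n #B ≤ min n (#B - 1) + 1 := by omega
          omega
      have h4 := sum_le_sum h3
      rw [sum_add_distrib, sum_add_distrib, ← sum_filter, sum_const, sum_const, sum_const,
        smul_eq_mul, smul_eq_mul, smul_eq_mul] at h4
      have h5 : ({x ∈ B.erase x₁ | x ∈ G} : Finset V) = G := by
        ext x; simp only [hG, mem_filter]; tauto
      rw [h5] at h4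
      have h6 : #(B.erase x₁) * h ≤ #G * (3 * n + h) := by
        rw [← hb] at hT
        rw [← hn, ← hT] at hs
        omega
      have h7 : #G * (3 * n + h) ≤ #G * ((6 * H + 1) * h) := by
        gcongr
        have := hS q hq
        nlinarith
      have h8 : #(B.erase x₁) ≤ (6 * H + 1) * #G :=
        le_of_mul_le_mul_right (h6.trans (h7.trans (le_of_eq (by ring)))) hh
      convert h8) hne' m
  refine ⟨{x₀, x₁} ∪ X, ?_, ?_, ?_⟩
  · exact union_subset (by simp [insert_subset_iff, hx₀, hx₁]) (hXB.trans (erase_subset _ _))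
  · refine (card_union_le _ _).trans ?_
    have := card_le_two (a := x₀) (b := x₁)
    omega
  · have h1 : #{q ∈ Q | ¬ #(S q) + min #(S q) #B ≤ #(S q + ({x₀, x₁} ∪ X)) + h} ≤
        #{q ∈ Q | ∀ x ∈ X, ¬ #(S q) + min #(S q) #B ≤ #(S q + {x₀, x₁, x}) + h} := by
      refine card_le_card fun q hq => ?_
      obtain ⟨hq, hlt⟩ := mem_filter.1 hq
      refine mem_filter.2 ⟨hq, fun x hx hc => hlt (hc.trans ?_)⟩
      gcongr
      intro y hy
      simp only [mem_insert, mem_singleton] at hy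
      simp only [mem_union, mem_insert, mem_singleton]
      rcases hy with rfl | rfl | rfl <;> simp [hx]
    set u := #{q ∈ Q | ∀ x ∈ X, ¬ #(S q) + min #(S q) #B ≤ #(S q + {x₀, x₁, x}) + h}
    have hu : (6 * H + 1) ^ m * u ≤ (6 * H) ^ m * #Q := by convert hle
    refine (Nat.mul_le_mul_left N h1).trans ?_
    rcases Nat.eq_zero_or_pos ((6 * H) ^ m) with h0 | h0
    · rw [h0, zero_mul] at hu
      have : 0 < (6 * H + 1) ^ m := by positivity
      have : u = 0 := by
        rcases Nat.eq_zero_or_pos u with hu0 | hu0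
        · exact hu0
        · have := Nat.mul_pos this hu0
          omega
      rw [this, mul_zero]
      exact Nat.zero_le _
    · refine le_of_mul_le_mul_left (le_trans ?_ hu) h0
      calc _ = (N * (6 * H) ^ m) * u := by ring
        _ ≤ _ := Nat.mul_le_mul_right _ hm

end Line

section LightFibres

/-- If all fibres of `L` are much smaller than `A₀`, which lies in a single fibre, then `L` has
nearly disjoint translates by elements of `A₀`. -/
lemma exists_translates_of_light_fibres {V W : Type*} [AddCommGroup V] [AddCommGroup W]
    (π : V →+ W) (L A₀ : Finset V) (p₀ : W) (hA₀ : ∀ x ∈ A₀, π x = p₀) (hne : A₀.Nonempty)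
    (j : ℕ) (hL : ∀ q, 2 * j * #{l ∈ L | π l = q} ≤ #A₀) :
    ∃ X ⊆ A₀, #X ≤ j ∧ j * #L ≤ 2 * #(L + X) := by
  have key : ∀ i ≤ j, ∃ X ⊆ A₀, #X ≤ i ∧ i * #L ≤ 2 * #(L + X) := by
    intro i
    induction i with
    | zero => exact fun _ => ⟨∅, by simp⟩
    | succ i ih =>
      intro hi
      obtain ⟨X, hXA, hX, hle⟩ := ih (by omega)
      have h1 : ∑ x ∈ A₀, #((L + {x}) ∩ (L + X)) ≤
          ∑ s ∈ L + X, #{l ∈ L | π l = π s - p₀} := by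
        rw [← card_sigma, ← card_sigma]
        refine card_le_card_of_injOn (fun t => ⟨t.2, t.2 - t.1⟩) ?_ ?_
        · rintro ⟨x, s⟩ ht
          simp only [coe_sigma, Set.mem_sigma_iff, mem_coe, mem_inter, mem_filter] at ht ⊢
          obtain ⟨hx, hsx, hsX⟩ := ht
          refine ⟨hsX, ?_, by rw [map_sub, hA₀ x hx]⟩
          obtain ⟨l, hl, y, hy, rfl⟩ := mem_add.1 hsx
          rw [mem_singleton.1 hy, add_sub_cancel_right]
          exact hl
        · rintro ⟨x, s⟩ _ ⟨y, t⟩ _ hxy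
          simp only [Sigma.mk.injEq, heq_eq_eq] at hxy
          obtain ⟨rfl, h⟩ := hxy
          rw [sub_right_inj.1 h]
      have h2 : 2 * j * ∑ s ∈ L + X, #{l ∈ L | π l = π s - p₀} ≤ #L * i * #A₀ := by
        calc _ = ∑ s ∈ L + X, 2 * j * #{l ∈ L | π l = π s - p₀} := mul_sum _ _ _
          _ ≤ ∑ s ∈ L + X, #A₀ := sum_le_sum fun s _ => hL _
          _ = #(L + X) * #A₀ := by simp
          _ ≤ _ := Nat.mul_le_mul_right _ (card_add_le.trans (Nat.mul_le_mul_left _ hX))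
      have h3 : 2 * ∑ x ∈ A₀, #((L + {x}) ∩ (L + X)) ≤ #L * #A₀ := by
        have hj : 0 < j := by omega
        have h1' := (Nat.mul_le_mul_left (2 * j) h1).trans h2
        generalize ∑ x ∈ A₀, #((L + {x}) ∩ (L + X)) = u at h1' ⊢
        have h6 : #L * i * #A₀ ≤ #L * j * #A₀ := by gcongr; omega
        nlinarith
      have h5 : ∑ x ∈ A₀, 2 * #((L + {x}) ∩ (L + X)) ≤ ∑ x ∈ A₀, #L := by
        rw [← mul_sum, sum_const, smul_eq_mul, mul_comm #A₀]
        exact h3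
      obtain ⟨x, hx, hxle⟩ := exists_le_of_sum_le hne h5
      refine ⟨insert x X, insert_subset hx hXA, (card_insert_le _ _).trans (by omega), ?_⟩
      rw [insert_eq, add_union]
      have h4 := card_union_add_card_inter (L + {x}) (L + X)
      rw [card_add_singleton] at h4
      rw [add_mul, one_mul]
      omega
  exact key j le_rfl

end LightFibres

section Layers

variable {W : Type*} [AddCommGroup W] [Module ℝ W]

/-- An adapted affine basis of a filtered finite set. -/
lemma exists_adapted_basis (P : Finset W) (lev : W → ℕ) {p₀ : W} (hp₀ : p₀ ∈ P)
    (hmax : ∀ p ∈ P, lev p ≤ lev p₀) :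
    ∃ Z ⊆ P, LinearIndepOn ℝ (fun z => z - p₀) (Z : Set W) ∧ #Z = affDim P ∧
      ∀ i ≤ lev p₀, ∀ p ∈ P, i ≤ lev p →
        p - p₀ ∈ Submodule.span ℝ ((fun z => z - p₀) '' {z | z ∈ Z ∧ i ≤ lev z}) := by
  have key : ∀ k ≤ lev p₀ + 1, ∃ Z ⊆ P, LinearIndepOn ℝ (fun z => z - p₀) (Z : Set W) ∧
      (∀ z ∈ Z, lev p₀ + 1 - k ≤ lev z) ∧
      ∀ i, lev p₀ + 1 - k ≤ i → ∀ p ∈ P, i ≤ lev p →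
        p - p₀ ∈ Submodule.span ℝ ((fun z => z - p₀) '' {z | z ∈ Z ∧ i ≤ lev z}) := by
    intro k
    induction k with
    | zero =>
      refine fun _ => ⟨∅, by simp, by simp, by simp, fun i hi p hp hip => ?_⟩
      have := hmax p hp
      omega
    | succ k ih =>
      intro hk
      obtain ⟨Z, hZP, hZ, hlev, hspan⟩ := ih (by omega)
      obtain ⟨Z', hZ', hZZ', hsub, hli⟩ := exists_linearIndepOn_extension hZ
        (t := (({p ∈ P | lev p₀ - k ≤ lev p} : Finset W) : Set W)) (by
          intro z hz
          simp only [coe_filter, Set.mem_ofPred_eq]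
          exact ⟨hZP hz, by have := hlev z hz; omega⟩)
      have hfin : Z'.Finite := (finite_toSet _).subset hZ'
      have hmem : ∀ z, z ∈ hfin.toFinset ↔ z ∈ Z' := fun z => hfin.mem_toFinset
      have hZ'' : ∀ z ∈ Z', z ∈ P ∧ lev p₀ - k ≤ lev z := fun z hz => by
        simpa using hZ' hz
      refine ⟨hfin.toFinset, fun z hz => (hZ'' z ((hmem z).1 hz)).1, by simpa using hli,
        fun z hz => by have := (hZ'' z ((hmem z).1 hz)).2; omega, fun i hi p hp hip => ?_⟩
      rcases Nat.lt_or_ge i (lev p₀ + 1 - k) with h | h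
      · obtain rfl : i = lev p₀ - k := by omega
        have h1 := hsub (Set.mem_image_of_mem (fun z => z - p₀) (mem_coe.2 (mem_filter.2 ⟨hp, hip⟩)))
        refine Submodule.span_mono (Set.image_mono fun z hz => ?_) h1
        exact ⟨(hmem z).2 hz, (hZ'' z hz).2⟩
      · refine Submodule.span_mono (Set.image_mono fun z hz => ?_) (hspan i h p hp hip)
        exact ⟨(hmem z).2 (hZZ' hz.1), hz.2⟩
  obtain ⟨Z, hZP, hZ, -, hspan⟩ := key (lev p₀ + 1) le_rfl
  refine ⟨Z, hZP, hZ, ?_, fun i _ => hspan i (by omega)⟩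
  have h0 : Submodule.span ℝ ((fun z => z - p₀) '' (Z : Set W)) = vectorSpan ℝ (P : Set W) := by
    rw [vectorSpan_eq_span_image_sub hp₀]
    refine le_antisymm (Submodule.span_mono ?_) (Submodule.span_le.2 ?_)
    · exact Set.image_mono (by exact_mod_cast hZP)
    · rintro _ ⟨p, hp, rfl⟩
      simpa using hspan 0 (by omega) p hp (Nat.zero_le _)
  rw [affDim, ← h0, Set.image_eq_range]
  exact ((finrank_span_eq_card (R := ℝ) hZ).trans (by simp)).symm

lemma affDim_mono {A B : Finset W} (h : A ⊆ B) : affDim A ≤ affDim B := by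
  have : FiniteDimensional ℝ (vectorSpan ℝ (B : Set W)) :=
    finiteDimensional_vectorSpan_of_finite ℝ B.finite_toSet
  exact Submodule.finrank_mono (vectorSpan_mono ℝ (by exact_mod_cast h))

end Layers

section Layers

variable {W : Type*} [AddCommGroup W] [Module ℝ W]

lemma sum_layers_le (P : Finset W) (lev : W → ℕ) {p₀ : W} (hp₀ : p₀ ∈ P)
    (hmax : ∀ p ∈ P, lev p ≤ lev p₀) :
    ∃ Z ⊆ P, #Z = affDim P ∧ ∀ (h : ℕ) (Y : ℕ → Finset W) (U : Finset W) (wt : W → ℕ),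
      (∀ i ∈ Icc 2 (lev p₀), Y i ⊆ {p ∈ P | i ≤ lev p}) → (∀ i ∈ Icc 2 (lev p₀), Y i ⊆ U) →
      Z ⊆ U → (∀ q ∈ P, ∀ y ∈ U, h * (lev q + min (lev q) (lev y) - 1) ≤ wt (q + y)) →
      h * ∑ i ∈ Icc 2 (lev p₀), (2 * #({p ∈ P | i ≤ lev p} + Y i) +
        (affDim P - affDim {p ∈ P | i ≤ lev p}) * #{p ∈ P | i ≤ lev p}) ≤
        ∑ s ∈ P + U, wt s := by
  obtain ⟨Z, hZP, hZ, hcard, hspan⟩ := exists_adapted_basis P lev hp₀ hmax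
  refine ⟨Z, hZP, hcard, fun h Y U wt hY hYU hZU hwt => ?_⟩
  set L : ℕ → Finset W := fun i => {p ∈ P | i ≤ lev p} with hL
  have memL : ∀ {i p}, p ∈ L i ↔ p ∈ P ∧ i ≤ lev p := by simp [hL]
  set N : ℕ → Finset W := fun i => {z ∈ Z | ¬ i ≤ lev z} with hN
  have memN : ∀ {i z}, z ∈ N i ↔ z ∈ Z ∧ ¬ i ≤ lev z := by simp [hN]
  -- differences of points of a layer lie in the span of the basis elements of that layer
  have hfree : ∀ i ≤ lev p₀, ∀ z ∈ N i, ∀ p ∈ L i, ∀ q ∈ L i, ∀ y, y ∈ L i ∨ (y ∈ Z ∧ y ≠ z) →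
      q + z ≠ p + y := by
    intro i hi z hz p hp q hq y hy heq
    obtain ⟨hzZ, hzi⟩ := memN.1 hz
    have hsub : {z' | z' ∈ Z ∧ i ≤ lev z'} ⊆ (Z : Set W) \ {z} := by
      rintro z' ⟨h1, h2⟩
      exact ⟨h1, fun h3 => hzi (by rwa [Set.mem_singleton_iff.1 h3] at h2)⟩
    have hin : ∀ p ∈ L i, p - p₀ ∈ Submodule.span ℝ ((fun z => z - p₀) '' ((Z : Set W) \ {z})) :=
      fun p hp => Submodule.span_mono (Set.image_mono hsub)
        (hspan i hi p (memL.1 hp).1 (memL.1 hp).2)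
    have hyin : y - p₀ ∈ Submodule.span ℝ ((fun z => z - p₀) '' ((Z : Set W) \ {z})) := by
      rcases hy with hy | ⟨hyZ, hyz⟩
      · exact hin y hy
      · exact Submodule.subset_span ⟨y, ⟨hyZ, hyz⟩, rfl⟩
    refine linearIndepOn_iff_notMem_span.1 hZ z hzZ ?_
    have : z - p₀ = (p - p₀) + (y - p₀) - (q - p₀) := by
      have : z = p + y - q := by rw [← heq]; abel
      rw [this]; abel
    rw [this]
    exact Submodule.sub_mem _ (Submodule.add_mem _ (hin p hp) hyin) (hin q hq)
  have hdisj : ∀ i ∈ Icc 2 (lev p₀), Disjoint (L i + Y i) (L i + N i) := by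
    intro i hi
    rw [disjoint_left]
    intro s hs hs'
    obtain ⟨p, hp, y, hy, rfl⟩ := mem_add.1 hs
    obtain ⟨q, hq, z, hz, heq⟩ := mem_add.1 hs'
    exact hfree i (mem_Icc.1 hi).2 z hz p hp q hq y (Or.inl (hY i hi hy)) heq
  have hNcard : ∀ i ∈ Icc 2 (lev p₀), (affDim P - affDim (L i)) * #(L i) ≤ #(L i + N i) := by
    intro i hi
    have hi' := (mem_Icc.1 hi).2
    have h1 : #(L i + N i) = #(L i) * #(N i) := by
      refine card_add_iff.2 ?_
      rintro ⟨q, z⟩ hqz ⟨p, y⟩ hpy heq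
      simp only [Set.mem_prod, mem_coe] at hqz hpy heq
      have : y = z := by
        by_contra hne
        exact hfree i hi' z hqz.2 p hpy.1 q hqz.1 y (Or.inr ⟨(memN.1 hpy.2).1, hne⟩) heq
      subst this
      rw [add_left_inj] at heq
      rw [heq]
    have h2 : #{z ∈ Z | i ≤ lev z} ≤ affDim (L i) := by
      have hp₀L : p₀ ∈ L i := memL.2 ⟨hp₀, hi'⟩
      have h3 : LinearIndepOn ℝ (fun z => z - p₀) (({z ∈ Z | i ≤ lev z} : Finset W) : Set W) :=
        hZ.mono (mod_cast filter_subset _ _)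
      have h4 := finrank_span_eq_card (R := ℝ) h3
      have h5 : Module.finrank ℝ (Submodule.span ℝ ((fun z => z - p₀) ''
          (({z ∈ Z | i ≤ lev z} : Finset W) : Set W))) ≤ affDim (L i) := by
        have : FiniteDimensional ℝ (vectorSpan ℝ (L i : Set W)) :=
          finiteDimensional_vectorSpan_of_finite ℝ (L i).finite_toSet
        refine Submodule.finrank_mono ?_
        rw [vectorSpan_eq_span_image_sub hp₀L]
        refine Submodule.span_mono (Set.image_mono fun z hz => ?_)
        have hz' := mem_filter.1 (mem_coe.1 hz)
        exact mem_coe.2 (memL.2 ⟨hZP hz'.1, hz'.2⟩)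
      rw [Set.image_eq_range] at h5
      exact le_trans (le_of_eq ((by simp : _ = _).trans h4.symm)) h5
    have h3 := card_filter_add_card_filter_not (s := Z) (fun z => i ≤ lev z)
    rw [h1, mul_comm #(L i)]
    refine Nat.mul_le_mul_right _ ?_
    change #_ + #(N i) = _ at h3
    omega
  have hpoint : ∀ s ∈ P + U, h * ∑ i ∈ Icc 2 (lev p₀),
      (2 * (if s ∈ L i + Y i then 1 else 0) + if s ∈ L i + N i then 1 else 0) ≤ wt s := by
    intro s hs
    set F₁ : Finset ℕ := {i ∈ Icc 2 (lev p₀) | s ∈ L i + Y i} with hF₁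
    set F₂ : Finset ℕ := {i ∈ Icc 2 (lev p₀) | s ∈ L i + Y i ∨ s ∈ L i + N i} with hF₂
    have hF : F₁ ⊆ F₂ := fun i hi => by
      simp only [hF₁, hF₂, mem_filter] at hi ⊢
      tauto
    have hsum : ∑ i ∈ Icc 2 (lev p₀),
        (2 * (if s ∈ L i + Y i then 1 else 0) + if s ∈ L i + N i then 1 else 0) =
        #F₁ + #F₂ := by
      rw [hF₁, hF₂, card_filter, card_filter, ← sum_add_distrib]
      refine sum_congr rfl fun i hi => ?_
      have : s ∈ L i + Y i → s ∉ L i + N i := fun h => disjoint_left.1 (hdisj i hi) h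
      by_cases h1 : s ∈ L i + Y i
      · simp [h1, this h1]
      · simp [h1]
    rw [hsum]
    have hbound : ∀ F ⊆ Icc 2 (lev p₀), ∀ t, (∀ i ∈ F, i ≤ t) → #F ≤ t - 1 := by
      intro F hF t ht
      refine (card_le_card (t := Icc 2 t) fun i hi => ?_).trans (by simp)
      exact mem_Icc.2 ⟨(mem_Icc.1 (hF hi)).1, ht i hi⟩
    rcases F₂.eq_empty_or_nonempty with h0 | hne
    · have : F₁ = ∅ := subset_empty.1 (h0 ▸ hF)
      simp [h0, this]
    obtain ⟨t₂, ht₂, hmax₂⟩ := exists_max_image F₂ id hne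
    obtain ⟨ht₂I, ht₂s⟩ := mem_filter.1 ht₂
    have hc₂ := hbound F₂ (filter_subset _ _) t₂ hmax₂
    have ht₂' := mem_Icc.1 ht₂I
    by_cases ht₁ : s ∈ L t₂ + Y t₂
    · have hc₁ := hbound F₁ (filter_subset _ _) t₂ fun i hi => hmax₂ i (hF hi)
      obtain ⟨q, hq, y, hy, rfl⟩ := mem_add.1 ht₁
      have hq' := memL.1 hq
      have hy' := memL.1 (hY t₂ ht₂I hy)
      refine le_trans (Nat.mul_le_mul_left h ?_) (hwt q hq'.1 y (hYU t₂ ht₂I hy))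
      omega
    · obtain ⟨q, hq, z, hz, rfl⟩ := mem_add.1 (ht₂s.resolve_left ht₁)
      have hq' := memL.1 hq
      have hz' := memN.1 hz
      have hc₁ := hbound F₁ (filter_subset _ _) (lev z) fun i hi => by
        by_contra hzi
        obtain ⟨hiI, his⟩ := mem_filter.1 hi
        obtain ⟨p, hp, y, hy, heq⟩ := mem_add.1 his
        have hit : i ≤ t₂ := hmax₂ i (hF hi)
        exact hfree i (mem_Icc.1 hiI).2 z (memN.2 ⟨hz'.1, hzi⟩) p hp q
          (memL.2 ⟨hq'.1, hit.trans hq'.2⟩) y (Or.inl (hY i hiI hy)) heq.symm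
      refine le_trans (Nat.mul_le_mul_left h ?_) (hwt q hq'.1 z (hZU hz'.1))
      omega
  have hsubY : ∀ i ∈ Icc 2 (lev p₀), L i + Y i ⊆ P + U := fun i hi =>
    add_subset_add (filter_subset _ _) (hYU i hi)
  have hsubN : ∀ i, L i + N i ⊆ P + U := fun i =>
    add_subset_add (filter_subset _ _) ((filter_subset _ _).trans hZU)
  calc h * ∑ i ∈ Icc 2 (lev p₀), (2 * #(L i + Y i) + (affDim P - affDim (L i)) * #(L i))
      ≤ h * ∑ i ∈ Icc 2 (lev p₀), (2 * #(L i + Y i) + #(L i + N i)) :=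
        Nat.mul_le_mul_left _ (sum_le_sum fun i hi => Nat.add_le_add_left (hNcard i hi) _)
    _ = h * ∑ i ∈ Icc 2 (lev p₀), ∑ s ∈ P + U,
          (2 * (if s ∈ L i + Y i then 1 else 0) + if s ∈ L i + N i then 1 else 0) := by
        congr 1
        refine sum_congr rfl fun i hi => ?_
        rw [sum_add_distrib, ← mul_sum, ← card_filter, ← card_filter,
          filter_mem_eq_inter, filter_mem_eq_inter, inter_eq_right.2 (hsubY i hi),
          inter_eq_right.2 (hsubN i)]
    _ = ∑ s ∈ P + U, h * ∑ i ∈ Icc 2 (lev p₀),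
          (2 * (if s ∈ L i + Y i then 1 else 0) + if s ∈ L i + N i then 1 else 0) := by
        rw [sum_comm, mul_sum]
    _ ≤ _ := sum_le_sum hpoint

end Layers

section LayerTranslates

lemma card_le_one_of_affDim_eq_zero {V : Type*} [AddCommGroup V] [Module ℝ V] (A : Finset V)
    (h : affDim A = 0) : #A ≤ 1 := by
  have : FiniteDimensional ℝ (vectorSpan ℝ (A : Set V)) :=
    finiteDimensional_vectorSpan_of_finite ℝ A.finite_toSet
  have h0 : vectorSpan ℝ (A : Set V) = ⊥ := Submodule.finrank_eq_zero.1 h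
  refine card_le_one.2 fun a ha b hb => ?_
  have := vsub_mem_vectorSpan ℝ (mem_coe.2 ha) (mem_coe.2 hb)
  rw [h0, Submodule.mem_bot, vsub_eq_sub] at this
  exact sub_eq_zero.1 this

/-- The conclusion of the main theorem in dimension `d`. -/
def FewTranslatesSuffice (d : ℕ) : Prop :=
  ∃ c : ℕ, ∀ (V : Type) [AddCommGroup V] [Module ℝ V] (A : Finset V), A.Nonempty → affDim A = d →
    ∃ X ⊆ A, #X ≤ c ∧ (d + 1) * #A ≤ #(A + X) + 5 * (d + 1) ^ 3

lemma exists_layer_translates (d : ℕ) (ih : ∀ e < d, FewTranslatesSuffice e) :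
    ∃ c : ℕ, ∀ (W : Type) [AddCommGroup W] [Module ℝ W] (P : Finset W), P.Nonempty →
      affDim P < d → ∃ Y ⊆ P, #Y ≤ c ∧ (affDim P + 2) * #P ≤ 2 * #(P + Y) ∧
        (affDim P + 2 ≤ #P →
          #P ≤ (d + 1) * (2 * #(P + Y) - (affDim P + 2) * #P)) := by
  choose! c hc using ih
  refine ⟨20 * d ^ 3 + ∑ e ∈ range d, c e, fun W _ _ P hP he => ?_⟩
  have hcard := affDim_add_one_le_card hP
  rcases Nat.lt_or_ge (20 * d ^ 3) #P with hlarge | hsmall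
  · obtain ⟨Y, hYP, hY, hle⟩ := hc _ he W P hP rfl
    have h1 : c (affDim P) ≤ ∑ e ∈ range d, c e :=
      single_le_sum (f := c) (fun _ _ => Nat.zero_le _) (mem_range.2 he)
    have he0 : 1 ≤ affDim P := by
      by_contra h0
      have := card_le_one_of_affDim_eq_zero P (by omega)
      have : 0 < d ^ 3 := by apply pow_pos; omega
      omega
    have h2 : (affDim P + 1) ^ 3 ≤ d ^ 3 := by gcongr; omega
    have h3 : (affDim P + 2) * #P + #P ≤ 2 * #(P + Y) + 10 * d ^ 3 := by nlinarith
    refine ⟨Y, hYP, by omega, by omega, fun _ => ?_⟩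
    have h4 : #P ≤ 2 * (2 * #(P + Y) - (affDim P + 2) * #P) := by omega
    refine h4.trans (Nat.mul_le_mul_right _ (by omega))
  · have hF := freiman_lemma P hP
    obtain ⟨k, hk⟩ := Nat.exists_eq_add_of_le hcard
    refine ⟨P, Subset.rfl, by omega, ?_, fun h2 => ?_⟩
    · rw [hk] at hF ⊢
      nlinarith
    · have he0 : 1 ≤ affDim P := by
        by_contra h0
        have := card_le_one_of_affDim_eq_zero P (by omega)
        omega
      have h3 : affDim P * k ≤ 2 * #(P + P) - (affDim P + 2) * #P := by
        rw [hk] at hF ⊢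
        refine Nat.le_sub_of_add_le ?_
        nlinarith
      have h4 : #P ≤ (d + 1) * k := by
        rw [hk]
        nlinarith
      refine h4.trans (Nat.mul_le_mul_left _ (le_trans ?_ h3))
      exact Nat.le_mul_of_pos_left _ he0

end LayerTranslates

section Fibres

variable {V W : Type*} [AddCommGroup V] [Module ℝ V] [AddCommGroup W] [Module ℝ W]

lemma exists_projection {A : Finset V} {v : V} (hv : v ≠ 0) (hvA : v ∈ vectorSpan ℝ (A : Set V)) :
    ∃ f : V →ₗ[ℝ] ℝ, (∀ x, (Submodule.span ℝ {v}).mkQ x = 0 → f x = 0 → x = 0) ∧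
      affDim (A.image (Submodule.span ℝ {v}).mkQ) + 1 = affDim A := by
  obtain ⟨f, hf⟩ := Module.Projective.exists_dual_eq_one ℝ hv
  refine ⟨f, fun x hx hfx => ?_, ?_⟩
  · rw [Submodule.mkQ_apply, Submodule.Quotient.mk_eq_zero] at hx
    obtain ⟨r, rfl⟩ := Submodule.mem_span_singleton.1 hx
    rw [map_smul, hf, smul_eq_mul, mul_one] at hfx
    rw [hfx, zero_smul]
  · set π := (Submodule.span ℝ {v}).mkQ with hπ
    set S := vectorSpan ℝ (A : Set V) with hS
    have : FiniteDimensional ℝ S := finiteDimensional_vectorSpan_of_finite ℝ A.finite_toSet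
    have h1 : vectorSpan ℝ ((A.image π : Finset _) : Set (V ⧸ Submodule.span ℝ {v})) =
        S.map π := by
      rw [coe_image]
      exact (π.toAffineMap.map_vectorSpan (s := (A : Set V))).symm
    have h2 : LinearMap.ker (π.domRestrict S) = Submodule.span ℝ {⟨v, hvA⟩} := by
      ext x
      rw [LinearMap.mem_ker, LinearMap.domRestrict_apply, hπ, Submodule.mkQ_apply,
        Submodule.Quotient.mk_eq_zero, Submodule.mem_span_singleton, Submodule.mem_span_singleton]
      simp [Subtype.ext_iff]
    have h3 := LinearMap.finrank_range_add_finrank_ker (π.domRestrict S)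
    rw [h2, finrank_span_singleton (by simpa [Subtype.ext_iff] using hv),
      LinearMap.range_domRestrict] at h3
    rw [affDim, affDim, h1, h3]

/-- The part of `A` lying above `p`. -/
noncomputable def fibre (π : V →ₗ[ℝ] W) (A : Finset V) (p : W) : Finset V := {a ∈ A | π a = p}

lemma mem_fibre {π : V →ₗ[ℝ] W} {A : Finset V} {p : W} {a : V} :
    a ∈ fibre π A p ↔ a ∈ A ∧ π a = p := mem_filter

lemma fibre_subset (π : V →ₗ[ℝ] W) (A : Finset V) (p : W) : fibre π A p ⊆ A := filter_subset _ _

lemma fibre_nonempty {π : V →ₗ[ℝ] W} {A : Finset V} {p : W} (hp : p ∈ A.image π) :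
    (fibre π A p).Nonempty := by
  obtain ⟨a, ha, rfl⟩ := mem_image.1 hp
  exact ⟨a, mem_fibre.2 ⟨ha, rfl⟩⟩

lemma injOn_fibre {π : V →ₗ[ℝ] W} {f : V →ₗ[ℝ] ℝ} (hf : ∀ x, π x = 0 → f x = 0 → x = 0)
    (A : Finset V) (p : W) : Set.InjOn f (fibre π A p) := by
  intro x hx y hy hxy
  refine sub_eq_zero.1 (hf _ ?_ ?_)
  · rw [map_sub, (mem_fibre.1 (mem_coe.1 hx)).2, (mem_fibre.1 (mem_coe.1 hy)).2, sub_self]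
  · rw [map_sub, hxy, sub_self]

lemma sum_card_fibre (π : V →ₗ[ℝ] W) (A : Finset V) :
    ∑ p ∈ A.image π, #(fibre π A p) = #A :=
  (card_eq_sum_card_fiberwise fun _ ha => mem_image_of_mem _ ha).symm

lemma sum_card_fibre_le (π : V →ₗ[ℝ] W) (A : Finset V) (Q : Finset W) :
    ∑ p ∈ Q, #(fibre π A p) ≤ #A := by
  rw [← card_biUnion]
  · exact card_le_card (biUnion_subset.2 fun p _ => fibre_subset π A p)
  · intro p _ q _ hne
    rw [Function.onFun, disjoint_left]
    intro a ha ha'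
    exact hne ((mem_fibre.1 ha).2.symm.trans (mem_fibre.1 ha').2)

lemma card_fibre_add_le (π : V →ₗ[ℝ] W) (A : Finset V) {U : Finset W} {X : W → Finset V}
    (hX : ∀ y ∈ U, X y ⊆ fibre π A y) (q : W) {y : W} (hy : y ∈ U) :
    #(fibre π A q + X y) ≤ #(fibre π (A + U.biUnion X) (q + y)) := by
  refine card_le_card fun s hs => ?_
  obtain ⟨a, ha, x, hx, rfl⟩ := mem_add.1 hs
  refine mem_fibre.2 ⟨add_mem_add (mem_fibre.1 ha).1 (mem_biUnion.2 ⟨y, hy, hx⟩), ?_⟩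
  rw [map_add, (mem_fibre.1 ha).2, (mem_fibre.1 (hX y hy hx)).2]

end Fibres

section FewFibres

lemma sum_card_layers {W : Type*} (P : Finset W) (lev : W → ℕ) {m : ℕ} (hm : ∀ p ∈ P, lev p ≤ m) :
    ∑ i ∈ Icc 2 m, #{p ∈ P | i ≤ lev p} = ∑ p ∈ P, (lev p - 1) := by
  simp only [card_filter]
  rw [sum_comm]
  refine sum_congr rfl fun p hp => ?_
  rw [← card_filter]
  have : ({i ∈ Icc 2 m | i ≤ lev p} : Finset ℕ) = Icc 2 (lev p) := by
    ext i
    have := hm p hp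
    simp only [mem_filter, mem_Icc]
    omega
  rw [this, Nat.card_Icc]
  omega

lemma affDim_add_two_mul_card_le {W : Type*} [AddCommGroup W] [Module ℝ W] (P : Finset W)
    (hP : P.Nonempty) : (affDim P + 2) * #P ≤ 2 * #(P + P) := by
  have hF := freiman_lemma P hP
  obtain ⟨k, hk⟩ := Nat.exists_eq_add_of_le (affDim_add_one_le_card hP)
  rw [hk] at hF ⊢
  nlinarith

variable {V W : Type*} [AddCommGroup V] [Module ℝ V] [AddCommGroup W] [Module ℝ W]

/-- When `A` is covered by few lines, few translates suffice up to an error depending only on the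
number of lines. -/
lemma exists_translates_of_few_fibres (π : V →ₗ[ℝ] W) (f : V →ₗ[ℝ] ℝ)
    (hf : ∀ x, π x = 0 → f x = 0 → x = 0) (A : Finset V) (hA : A.Nonempty) :
    ∃ X ⊆ A, #X ≤ #(A.image π) * (#(A.image π) + 2) ∧
      (affDim (A.image π) + 2) * #A ≤
        #(A + X) + (affDim (A.image π) + 2) * #(A.image π) := by
  set P := A.image π with hP
  set n : W → ℕ := fun p => #(fibre π A p) with hn
  obtain ⟨p₀, hp₀, hmax⟩ := exists_max_image P n (hA.image π)
  have hX : ∀ y, ∃ X, y ∈ P → X ⊆ fibre π A y ∧ #X ≤ #P + 2 ∧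
      ∀ q ∈ P, n q + min (n q) (n y) ≤ #(fibre π A q + X) + 1 := by
    intro y
    by_cases hy : y ∈ P
    · obtain ⟨X, h1, h2, h3⟩ := exists_exact_translates f.toAddMonoidHom (fibre π A y)
        (injOn_fibre hf A y) (fibre_nonempty hy) P (fibre π A)
      exact ⟨X, fun _ => ⟨h1, h2, h3⟩⟩
    · exact ⟨∅, fun h => absurd h hy⟩
  choose X hX using hX
  obtain ⟨Z, hZP, -, hsum⟩ := sum_layers_le P n hp₀ hmax
  have h1 := hsum 1 (fun i => {p ∈ P | i ≤ n p}) P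
    (fun s => #(fibre π (A + P.biUnion X) s)) (fun _ _ => Subset.rfl)
    (fun _ _ => filter_subset _ _) hZP (fun q hq y hy => by
      have h2 := card_fibre_add_le π A (fun y hy => (hX y hy).1) q hy
      have h3 := (hX y hy).2.2 q hq
      omega)
  refine ⟨P.biUnion X, biUnion_subset.2 fun y hy => (hX y hy).1.trans (fibre_subset π A y),
    card_biUnion_le_card_mul _ _ _ fun y hy => (hX y hy).2.1, ?_⟩
  have h2 : (affDim P + 2) * ∑ i ∈ Icc 2 (n p₀), #{p ∈ P | i ≤ n p} ≤ #(A + P.biUnion X) := by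
    refine le_trans ?_ (h1.trans (sum_card_fibre_le π _ _))
    rw [one_mul, mul_sum]
    refine sum_le_sum fun i hi => ?_
    have h3 := affDim_add_two_mul_card_le {p ∈ P | i ≤ n p}
      ⟨p₀, mem_filter.2 ⟨hp₀, (mem_Icc.1 hi).2⟩⟩
    have h4 : affDim {p ∈ P | i ≤ n p} ≤ affDim P := affDim_mono (filter_subset _ _)
    obtain ⟨k, hk⟩ := Nat.exists_eq_add_of_le h4
    rw [hk, Nat.add_sub_cancel_left]
    nlinarith
  have h3 : #A ≤ ∑ p ∈ P, (n p - 1) + #P := by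
    rw [← sum_card_fibre π A, ← hP, card_eq_sum_ones, ← sum_add_distrib]
    exact sum_le_sum fun p _ => by simp only [hn]; omega
  rw [sum_card_layers P n hmax] at h2
  nlinarith

end FewFibres

section ManyFibres

/-- Rounding fibre sizes down to multiples of `h` loses little, provided light fibres are rare. -/
lemma sum_levels_ge {ι : Type*} (P : Finset ι) (n : ι → ℕ) {n₀ M t h : ℕ} (hM : 0 < M)
    (hh : 1 ≤ h) (hhn : 2 * M * t * h ≤ n₀)
    (hlight : t * ∑ p ∈ P with M * n p < n₀, n p ≤ ∑ p ∈ P, n p) :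
    t * ∑ p ∈ P, n p ≤ t * (h * ∑ p ∈ P, (n p / h - 1)) + 2 * ∑ p ∈ P, n p := by
  have hpt : ∀ p ∈ P, t * n p ≤ t * (h * (n p / h - 1)) + n p +
      if M * n p < n₀ then t * n p else 0 := by
    intro p _
    split_ifs with hp
    · omega
    · have h1 : n p < h * (n p / h) + h := by
        have := Nat.div_add_mod (n p) h
        have := Nat.mod_lt (n p) hh
        omega
      have h2 : n p ≤ h * (n p / h - 1) + 2 * h := by
        rcases Nat.eq_zero_or_pos (n p / h) with h0 | h0
        · rw [h0] at h1 ⊢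
          omega
        · obtain ⟨k, hk⟩ := Nat.exists_eq_add_of_le h0
          rw [hk] at h1 ⊢
          rw [Nat.add_sub_cancel_left]
          nlinarith
      have h3 : 2 * t * h ≤ n p := by
        refine le_of_mul_le_mul_left ?_ hM
        calc M * (2 * t * h) = 2 * M * t * h := by ring
          _ ≤ _ := by omega
      calc t * n p ≤ t * (h * (n p / h - 1) + 2 * h) := Nat.mul_le_mul_left _ h2
        _ = t * (h * (n p / h - 1)) + 2 * t * h := by ring
        _ ≤ _ := by omega
  have h1 := sum_le_sum hpt
  rw [sum_add_distrib, sum_add_distrib, ← mul_sum, ← mul_sum, ← mul_sum, ← sum_filter,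
    ← mul_sum] at h1
  omega

variable {V W : Type} [AddCommGroup V] [Module ℝ V] [AddCommGroup W] [Module ℝ W]

/-- If few translates never suffice, then light fibres contain a small part of `A`. -/
lemma sum_light_fibres_le (π : V →ₗ[ℝ] W) (A : Finset V) (p₀ : W)
    (hp₀ : (fibre π A p₀).Nonempty) (d j : ℕ) (hj : j = 12 * (d + 1) ^ 3)
    (hfew : ∀ X ⊆ A, #X ≤ j → #(A + X) < (d + 1) * #A) :
    6 * (d + 1) ^ 2 * ∑ p ∈ A.image π with 2 * j * #(fibre π A p) < #(fibre π A p₀),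
      #(fibre π A p) ≤ #A := by
  set L : Finset V := {a ∈ A | 2 * j * #(fibre π A (π a)) < #(fibre π A p₀)} with hL
  obtain ⟨X, hXA, hX, hle⟩ := exists_translates_of_light_fibres π.toAddMonoidHom L (fibre π A p₀)
    p₀ (fun x hx => (mem_fibre.1 hx).2) hp₀ j (by
      intro q
      by_cases hq : 2 * j * #(fibre π A q) < #(fibre π A p₀)
      · refine le_trans (Nat.mul_le_mul_left _ (card_le_card fun l hl => ?_)) hq.le
        obtain ⟨h1, h2⟩ := mem_filter.1 hl
        exact mem_fibre.2 ⟨(mem_filter.1 h1).1, h2⟩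
      · rw [filter_false_of_mem, card_empty, mul_zero]
        · exact Nat.zero_le _
        rintro l hl rfl
        exact hq (mem_filter.1 hl).2)
  have h1 := hfew X (hXA.trans (fibre_subset π A p₀)) hX
  have h2 : #(L + X) ≤ #(A + X) := card_le_card (add_subset_add_right (filter_subset _ _))
  have h3 : ∑ p ∈ A.image π with 2 * j * #(fibre π A p) < #(fibre π A p₀),
      #(fibre π A p) = #L := by
    rw [card_eq_sum_card_fiberwise (f := π) (s := L)
      (t := {p ∈ A.image π | 2 * j * #(fibre π A p) < #(fibre π A p₀)}) (by
        intro a ha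
        obtain ⟨ha, ha'⟩ := mem_filter.1 (mem_coe.1 ha)
        exact mem_coe.2 (mem_filter.2 ⟨mem_image_of_mem _ ha, ha'⟩))]
    refine sum_congr rfl fun p hp => congrArg card ?_
    ext a
    simp only [hL, mem_filter, mem_fibre]
    constructor
    · rintro ⟨h4, rfl⟩
      exact ⟨⟨h4, (mem_filter.1 hp).2⟩, rfl⟩
    · rintro ⟨⟨h4, -⟩, h5⟩
      exact ⟨h4, h5⟩
  rw [h3]
  refine le_of_mul_le_mul_left (a := 2 * (d + 1)) ?_ (by omega)
  calc 2 * (d + 1) * (6 * (d + 1) ^ 2 * #L) = j * #L := by rw [hj]; ring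
    _ ≤ _ := by linarith

lemma absurd_of_counts {d t a b g S N : ℕ} (hd : 1 ≤ d) (ht : t = 6 * (d + 1) ^ 2)
    (ha : a < (d + 1) * N) (hb : t * b ≤ N) (hg : 4 * g < N) (hS : t * N ≤ t * S + 2 * N)
    (h : ((d + 1) ^ 2 + 1) * S ≤ (d + 1) * (a + b) + g) : False := by
  obtain ⟨x, hx⟩ : ∃ x, x = d + 1 := ⟨_, rfl⟩
  rw [← hx] at ht ha h
  have hx2 : 2 ≤ x := by omega
  have h1 := Nat.mul_le_mul_left t h
  have h2 := Nat.mul_le_mul_left (x ^ 2 + 1) hS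
  have h3 := Nat.mul_le_mul_left x hb
  have h4 : t * x * a + t * x ≤ t * x * (x * N) := by
    rw [← Nat.mul_succ]; exact Nat.mul_le_mul_left _ ha
  have h5 : t * (4 * g) ≤ t * N := Nat.mul_le_mul_left t hg.le
  have h6 : 2 * (x ^ 2 + 1) * N + x * N ≤ 3 * x ^ 2 * N := by
    rw [← add_mul]
    exact Nat.mul_le_mul_right _ (by nlinarith)
  have h7 : t * N = 6 * x ^ 2 * N := by rw [ht]
  have h8 : 0 < x ^ 2 * N := Nat.mul_pos (by positivity) (by omega)
  nlinarith

/-- When no line contains a positive proportion of `A`, the layers of the projection gain enough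
to beat the required bound. -/
lemma exists_translates_of_many_fibres (d : ℕ) (hd : 1 ≤ d)
    (ih : ∀ e < d, FewTranslatesSuffice e) :
    ∃ c R : ℕ, ∀ (V W : Type) [AddCommGroup V] [Module ℝ V] [AddCommGroup W] [Module ℝ W]
      (π : V →ₗ[ℝ] W) (f : V →ₗ[ℝ] ℝ) (A : Finset V),
      (∀ x, π x = 0 → f x = 0 → x = 0) → affDim (A.image π) + 1 = d →
      (∃ p, R ≤ #(fibre π A p)) → (∀ p, 4 * d * #(fibre π A p) < #A) →
      ∃ X ⊆ A, #X ≤ c ∧ (d + 1) * #A ≤ #(A + X) := by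
  obtain ⟨c₁, hc₁⟩ := exists_layer_translates d ih
  obtain ⟨j, hj⟩ : ∃ j, j = 12 * (d + 1) ^ 3 := ⟨_, rfl⟩
  obtain ⟨t, ht⟩ : ∃ t, t = 6 * (d + 1) ^ 2 := ⟨_, rfl⟩
  obtain ⟨H, hH⟩ : ∃ H, H = 2 * (2 * j) * t := ⟨_, rfl⟩
  obtain ⟨c₂, hc₂⟩ : ∃ c₂, c₂ = 2 * H * c₁ + d := ⟨_, rfl⟩
  obtain ⟨m, hm⟩ := exists_approx_translates H (4 * H * c₂ * t)
  have hj0 : 0 < j := by rw [hj]; positivity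
  have ht0 : 0 < t := by rw [ht]; positivity
  have hH0 : 0 < H := by rw [hH]; positivity
  refine ⟨max j (c₂ * m), max H 1, fun V W _ _ _ _ π f A hf hdim hrich hthin => ?_⟩
  by_contra! hfew
  set P := A.image π with hP
  set n : W → ℕ := fun p => #(fibre π A p) with hn
  have hrich' : (A.image π).Nonempty := by
    obtain ⟨p, hp⟩ := hrich
    obtain ⟨a, ha⟩ := card_pos.1 (lt_of_lt_of_le (by omega) hp)
    exact ⟨_, mem_image_of_mem _ (mem_fibre.1 ha).1⟩
  obtain ⟨p₀, hp₀, hmax⟩ := exists_max_image P n hrich'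
  have hmax' : ∀ p, n p ≤ n p₀ := by
    intro p
    rcases (fibre π A p).eq_empty_or_nonempty with h0 | ⟨a, ha⟩
    · simp [hn, h0]
    · exact hmax p (mem_image.2 ⟨a, mem_fibre.1 ha⟩)
  have hn₀ : H ≤ n p₀ := by
    obtain ⟨p, hp⟩ := hrich
    exact (le_max_left _ _).trans (hp.trans (hmax' p))
  obtain ⟨h, hh⟩ : ∃ h, h = n p₀ / H := ⟨_, rfl⟩
  have hh1 : 1 ≤ h := by rw [hh]; exact (Nat.one_le_div_iff hH0).2 hn₀
  have hHh : H * h ≤ n p₀ := by rw [hh]; exact Nat.mul_div_le _ _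
  have hn₀h : n p₀ ≤ 2 * H * h := by
    have h1 := Nat.lt_mul_div_succ (n p₀) hH0
    rw [← hh] at h1
    nlinarith
  set lev : W → ℕ := fun p => n p / h with hlev
  have hlevh : ∀ p, h * lev p ≤ n p := fun p => Nat.mul_div_le _ _
  have hlevmax : ∀ p ∈ P, lev p ≤ lev p₀ := fun p hp => Nat.div_le_div_right (hmax p hp)
  have hlev₀ : lev p₀ ≤ 2 * H := by
    refine le_of_mul_le_mul_left ((hlevh p₀).trans (hn₀h.trans (le_of_eq ?_))) hh1
    ring
  set L : ℕ → Finset W := fun i => {p ∈ P | i ≤ lev p} with hL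
  obtain ⟨Z, hZP, hZ, hsum⟩ := sum_layers_le P lev hp₀ hlevmax
  -- translates for the layers
  have hY : ∀ i, ∃ Y, i ∈ Icc 2 (lev p₀) → Y ⊆ L i ∧ #Y ≤ c₁ ∧
      (affDim (L i) + 2) * #(L i) ≤ 2 * #(L i + Y) ∧ (affDim (L i) + 2 ≤ #(L i) →
        #(L i) ≤ (d + 1) * (2 * #(L i + Y) - (affDim (L i) + 2) * #(L i))) := by
    intro i
    by_cases hi : i ∈ Icc 2 (lev p₀)
    · have h1 : affDim (L i) ≤ affDim P := affDim_mono (filter_subset _ _)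
      obtain ⟨Y, hY⟩ := hc₁ W (L i) ⟨p₀, mem_filter.2 ⟨hp₀, (mem_Icc.1 hi).2⟩⟩ (by omega)
      exact ⟨Y, fun _ => hY⟩
    · exact ⟨∅, fun h => absurd h hi⟩
  choose Y hY using hY
  set U := Z ∪ (Icc 2 (lev p₀)).biUnion Y with hU
  have hUP : U ⊆ P := union_subset hZP
    (biUnion_subset.2 fun i hi => (hY i hi).1.trans (filter_subset _ _))
  have hUcard : #U ≤ c₂ := by
    refine (card_union_le _ _).trans ?_
    have h1 : #((Icc 2 (lev p₀)).biUnion Y) ≤ #(Icc 2 (lev p₀)) * c₁ :=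
      card_biUnion_le_card_mul _ _ _ fun i hi => (hY i hi).2.1
    rw [Nat.card_Icc] at h1
    have h2 : (lev p₀ + 1 - 2) * c₁ ≤ 2 * H * c₁ := Nat.mul_le_mul_right _ (by omega)
    omega
  -- translates inside the fibres
  set bad : W → (W → Finset V) → Finset W := fun y X =>
    {q ∈ L 1 | ¬ n q + min (n q) (n y) ≤ #(fibre π A q + X y) + h} with hbad
  have hX : ∃ X : W → Finset V, ∀ y ∈ U, X y ⊆ fibre π A y ∧ #(X y) ≤ m ∧
      4 * H * c₂ * t * #(bad y X) ≤ #(L 1) := by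
    have : ∀ y, ∃ X, y ∈ U → X ⊆ fibre π A y ∧ #X ≤ m ∧ 4 * H * c₂ * t *
        #{q ∈ L 1 | ¬ n q + min (n q) (n y) ≤ #(fibre π A q + X) + h} ≤ #(L 1) := by
      intro y
      by_cases hy : y ∈ U
      · obtain ⟨X, h1, h2, h3⟩ := hm f.toAddMonoidHom (fibre π A y) (injOn_fibre hf A y)
          (fibre_nonempty (hUP hy)) (L 1) (fibre π A) h hh1 fun q _ => (hmax' q).trans hn₀h
        exact ⟨X, fun _ => ⟨h1, h2, h3⟩⟩
      · exact ⟨∅, fun h => absurd h hy⟩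
    choose X hX using this
    exact ⟨X, hX⟩
  obtain ⟨X, hX⟩ := hX
  have hAX : #(A + U.biUnion X) < (d + 1) * #A := by
    refine hfew _ (biUnion_subset.2 fun y hy => (hX y hy).1.trans (fibre_subset π A y)) ?_
    refine le_trans ?_ (le_max_right _ _)
    exact (card_biUnion_le_card_mul _ _ _ fun y hy => (hX y hy).2.1).trans
      (Nat.mul_le_mul_right _ hUcard)
  -- the weighted count
  set B : Finset (W × W) := {t ∈ L 1 ×ˢ U | t.1 ∈ bad t.2 X} with hB
  have hwt := hsum h Y U
    (fun s => #(fibre π (A + U.biUnion X) s) + #{t ∈ B | t.1 + t.2 = s} * (2 * n p₀))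
    (fun i hi => (hY i hi).1)
    (fun i hi => (subset_biUnion_of_mem Y hi).trans subset_union_right) subset_union_left (by
      intro q hq y hy
      have h1 := card_fibre_add_le π A (fun y hy => (hX y hy).1) q hy
      rcases Nat.eq_zero_or_pos (lev q) with h0 | h0
      · simp [h0]
      by_cases hqy : q ∈ bad y X
      · have h2 : 1 ≤ #{t ∈ B | t.1 + t.2 = q + y} := card_pos.2 ⟨(q, y), mem_filter.2
          ⟨mem_filter.2 ⟨mem_product.2 ⟨mem_filter.2 ⟨hq, h0⟩, hy⟩, hqy⟩, rfl⟩⟩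
        have h3 : h * (lev q + min (lev q) (lev y) - 1) ≤ h * (2 * lev q) :=
          Nat.mul_le_mul_left _ (by omega)
        have h4 := hlevh q
        have h5 := hmax' q
        have h6 := Nat.mul_le_mul_right (2 * n p₀) h2
        nlinarith
      · have h2 : n q + min (n q) (n y) ≤ #(fibre π A q + X y) + h := by
          by_contra hc
          exact hqy (mem_filter.2 ⟨mem_filter.2 ⟨hq, h0⟩, hc⟩)
        have h3 : h * min (lev q) (lev y) ≤ min (n q) (n y) :=
          le_min ((Nat.mul_le_mul_left _ (min_le_left _ _)).trans (hlevh q))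
            ((Nat.mul_le_mul_left _ (min_le_right _ _)).trans (hlevh y))
        have h4 := hlevh q
        rw [Nat.mul_sub, Nat.mul_add, mul_one]
        omega)
  have hwt' : ∑ s ∈ P + U, (#(fibre π (A + U.biUnion X) s) +
      #{t ∈ B | t.1 + t.2 = s} * (2 * n p₀)) ≤ #(A + U.biUnion X) + #B * (2 * n p₀) := by
    rw [sum_add_distrib, ← sum_mul]
    refine Nat.add_le_add (sum_card_fibre_le π _ _) (Nat.mul_le_mul_right _ ?_)
    refine (card_eq_sum_card_fiberwise (f := fun t : W × W => t.1 + t.2) (s := B)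
      (t := P + U) ?_).symm.le
    rintro ⟨q, y⟩ hqy
    have h1 := mem_product.1 (mem_filter.1 (mem_coe.1 hqy)).1
    exact mem_coe.2 (add_mem_add (mem_filter.1 h1.1).1 h1.2)
  have hA : ∑ p ∈ P, n p = #A := sum_card_fibre π A
  have hL1 : h * #(L 1) ≤ #A := by
    rw [← hA, card_filter, mul_sum]
    refine sum_le_sum fun p _ => ?_
    split_ifs with h1
    · have := hlevh p
      nlinarith
    · simp
  have hBcard : t * (#B * (2 * n p₀)) ≤ #A := by
    have h1 : #B = ∑ y ∈ U, #(bad y X) := by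
      rw [card_eq_sum_card_fiberwise (f := Prod.snd) (t := U)]
      · refine sum_congr rfl fun y hy => ?_
        refine card_nbij' Prod.fst (fun q => (q, y)) ?_ ?_ ?_ ?_
        · rintro ⟨q, y'⟩ h1
          obtain ⟨hqB, h2⟩ := mem_filter.1 (mem_coe.1 h1)
          rw [hB] at hqB
          have h3 := (mem_filter.1 hqB).2
          simp only at h2 h3
          rw [h2] at h3
          exact mem_coe.2 h3
        · intro q hq
          exact mem_coe.2 (mem_filter.2 ⟨mem_filter.2 ⟨mem_product.2
            ⟨(mem_filter.1 (mem_coe.1 hq)).1, hy⟩, mem_coe.1 hq⟩, rfl⟩)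
        · rintro ⟨q, y'⟩ h1
          obtain ⟨h1, rfl⟩ := mem_filter.1 (mem_coe.1 h1)
          rfl
        · intro q _
          rfl
      · intro t ht
        exact mem_coe.2 (mem_product.1 (mem_filter.1 (mem_coe.1 ht)).1).2
    have h2 : 4 * H * c₂ * t * #B ≤ c₂ * #(L 1) := by
      rw [h1, mul_sum]
      refine (sum_le_sum fun y hy => (hX y hy).2.2).trans ?_
      rw [sum_const, smul_eq_mul]
      exact Nat.mul_le_mul_right _ hUcard
    have hc₂0 : 0 < c₂ := by omega
    have h3 : 4 * H * t * #B ≤ #(L 1) := by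
      refine le_of_mul_le_mul_left (le_trans (le_of_eq ?_) h2) hc₂0
      ring
    calc t * (#B * (2 * n p₀)) ≤ t * (#B * (2 * (2 * H * h))) := by gcongr
      _ = h * (4 * H * t * #B) := by ring
      _ ≤ h * #(L 1) := Nat.mul_le_mul_left _ h3
      _ ≤ _ := hL1
  have hlight := sum_light_fibres_le π A p₀ (fibre_nonempty hp₀) d j hj
    fun X hX hXc => hfew X hX (hXc.trans (le_max_left _ _))
  have hlevels := sum_levels_ge P n (n₀ := n p₀) (M := 2 * j) (t := t) (h := h) (by omega) hh1
    (by rw [← hH]; exact hHh) (by rw [hA, ht]; exact hlight)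
  rw [hA, ← sum_card_layers P lev hlevmax] at hlevels
  -- comparison of the layers
  have hlayer : ∀ i ∈ Icc 2 (lev p₀), ((d + 1) ^ 2 + 1) * #(L i) ≤
      (d + 1) * (2 * #(L i + Y i) + (affDim P - affDim (L i)) * #(L i)) + d := by
    intro i hi
    obtain ⟨-, -, h1, h2⟩ := hY i hi
    have h3 : affDim (L i) ≤ affDim P := affDim_mono (filter_subset _ _)
    obtain ⟨k, hk⟩ := Nat.exists_eq_add_of_le h3
    obtain ⟨E, hE⟩ := Nat.exists_eq_add_of_le h1
    have hde : d = affDim (L i) + k + 1 := by omega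
    rw [hE, Nat.add_sub_cancel_left] at h2
    rw [hE, hk, Nat.add_sub_cancel_left]
    have h4 : #(L i) ≤ (d + 1) * E + d := by
      rcases Nat.lt_or_ge #(L i) (affDim (L i) + 2) with h5 | h5
      · omega
      · exact (h2 h5).trans (Nat.le_add_right _ _)
    have h6 : (d + 1) * ((affDim (L i) + 2) * #(L i) + E + k * #(L i)) =
        (d + 1) ^ 2 * #(L i) + (d + 1) * E := by rw [hde]; ring
    rw [h6]
    linarith
  have htotal : ((d + 1) ^ 2 + 1) * (h * ∑ i ∈ Icc 2 (lev p₀), #(L i)) ≤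
      (d + 1) * (#(A + U.biUnion X) + #B * (2 * n p₀)) + d * n p₀ := by
    have h1 := sum_le_sum hlayer
    rw [← mul_sum, sum_add_distrib, ← mul_sum, sum_const, Nat.card_Icc, smul_eq_mul] at h1
    have h2 : (lev p₀ + 1 - 2) * d * h ≤ d * n p₀ := by
      calc (lev p₀ + 1 - 2) * d * h ≤ lev p₀ * d * h := by gcongr; omega
        _ = d * (h * lev p₀) := by ring
        _ ≤ _ := Nat.mul_le_mul_left _ (hlevh p₀)
    have h3 := Nat.mul_le_mul_left (d + 1) (hwt.trans hwt')
    have h4 := Nat.mul_le_mul_left h h1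
    rw [mul_left_comm]
    refine h4.trans ?_
    rw [mul_add, mul_left_comm]
    exact Nat.add_le_add h3 (by rwa [mul_comm])
  have hthin₀ : 4 * (d * n p₀) < #A := by
    have := hthin p₀
    rwa [mul_assoc] at this
  exact absurd_of_counts hd ht hAX hBcard hthin₀ hlevels htotal

end ManyFibres

section MainInduction

variable {V W : Type*} [AddCommGroup V] [Module ℝ V] [AddCommGroup W] [Module ℝ W]

lemma exists_card_mul_card_fibre_le (π : V →ₗ[ℝ] W) (A : Finset V) (p : W) {m : ℕ}
    (hm : m ≤ #(A.image π)) : ∃ X ⊆ A, #X = m ∧ m * #(fibre π A p) ≤ #(A + X) := by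
  obtain ⟨Y, hY, rfl⟩ := exists_subset_card_eq hm
  have hg : ∀ y ∈ Y, ∃ a ∈ A, π a = y := fun y hy => mem_image.1 (hY hy)
  choose! g hgA hgπ using hg
  refine ⟨Y.image g, image_subset_iff.2 hgA, card_image_of_injOn fun y hy z hz h => ?_, ?_⟩
  · rw [← hgπ y hy, h, hgπ z hz]
  · rw [mul_comm, ← card_product]
    refine card_le_card_of_injOn (fun t => t.1 + g t.2) ?_ ?_
    · rintro ⟨a, y⟩ h
      obtain ⟨ha, hy⟩ := mem_product.1 (mem_coe.1 h)
      exact mem_coe.2 (add_mem_add (mem_fibre.1 ha).1 (mem_image_of_mem g hy))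
    · rintro ⟨a, y⟩ h ⟨b, z⟩ h' hab
      obtain ⟨ha, hy⟩ := mem_product.1 (mem_coe.1 h)
      obtain ⟨hb, hz⟩ := mem_product.1 (mem_coe.1 h')
      simp only at ha hy hb hz hab
      have hyz : y = z := by
        have h1 := congrArg π hab
        rw [map_add, map_add, (mem_fibre.1 ha).2, (mem_fibre.1 hb).2, hgπ y hy, hgπ z hz] at h1
        exact add_left_cancel h1
      subst hyz
      rw [add_right_cancel hab]

lemma fewTranslatesSuffice_zero : FewTranslatesSuffice 0 := by
  refine ⟨0, fun V _ _ A _ hA => ⟨∅, empty_subset _, le_rfl, ?_⟩⟩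
  have := card_le_one_of_affDim_eq_zero A hA
  omega

theorem fewTranslatesSuffice (d : ℕ) : FewTranslatesSuffice d := by
  induction d using Nat.strong_induction_on with
  | _ d ih =>
  rcases Nat.eq_zero_or_pos d with rfl | hd
  · exact fewTranslatesSuffice_zero
  obtain ⟨c₁, R, hmany⟩ := exists_translates_of_many_fibres d hd ih
  obtain ⟨C, c₂, hdoubling⟩ := exists_card_add_self_le (d + 1)
  obtain ⟨N, hline⟩ := exists_rich_line_of_card_add_self_le C (max R 2)
  obtain ⟨m, hm⟩ : ∃ m, m = 4 * d * (d + 1) := ⟨_, rfl⟩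
  refine ⟨c₁ + c₂ + N + m * (m + 2), fun V _ _ A hA hdim => ?_⟩
  by_contra! hfew
  have hfew' : ∀ X ⊆ A, #X ≤ c₁ + c₂ + N + m * (m + 2) → #(A + X) < (d + 1) * #A :=
    fun X hX hXc => (Nat.le_add_right _ _).trans_lt (hfew X hX hXc)
  rcases le_or_gt #A N with hAN | hAN
  · have h1 := hfew A Subset.rfl (by omega)
    have h2 := freiman_lemma A hA
    rw [hdim] at h2
    nlinarith [Nat.zero_le (d ^ 3), Nat.zero_le (d ^ 2)]
  obtain ⟨v, hv, a, ha, hrich⟩ := hline V A hAN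
    (hdoubling V A fun X hX hXc => hfew' X hX (by omega))
  have hvA : v ∈ vectorSpan ℝ (A : Set V) := by
    obtain ⟨x, hx, hxa⟩ := exists_mem_ne (lt_of_lt_of_le one_lt_two
      ((le_max_right _ _).trans hrich)) a
    obtain ⟨hxA, hxv⟩ := mem_filter.1 hx
    obtain ⟨r, hr⟩ := Submodule.mem_span_singleton.1 hxv
    have hr0 : r ≠ 0 := by
      rintro rfl
      rw [zero_smul] at hr
      exact hxa (sub_eq_zero.1 hr.symm)
    rw [← Submodule.smul_mem_iff _ hr0, hr]
    exact vsub_mem_vectorSpan ℝ (mem_coe.2 hxA) (mem_coe.2 ha)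
  obtain ⟨f, hf, hdim'⟩ := exists_projection hv hvA
  rw [hdim] at hdim'
  generalize hπ : (Submodule.span ℝ {v}).mkQ = π at hf hdim'
  by_cases hheavy : ∃ p, #A ≤ 4 * d * #(fibre π A p)
  · obtain ⟨p, hp⟩ := hheavy
    have hfibres : #(A.image π) ≤ m := by
      by_contra! hlt
      obtain ⟨X, hXA, hXm, hX⟩ := exists_card_mul_card_fibre_le π A p hlt.le
      have h1 := hfew' X hXA (by nlinarith)
      rw [hm] at hX
      nlinarith
    obtain ⟨X, hXA, hXc, hX⟩ := exists_translates_of_few_fibres π f hf A hA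
    have h1 := hfew X hXA (hXc.trans (by nlinarith))
    have h2 : affDim (A.image π) + 2 = d + 1 := by omega
    rw [h2] at hX
    have h3 := Nat.mul_le_mul_left (d + 1) hfibres
    rw [hm] at h3
    nlinarith [Nat.zero_le (d ^ 3), Nat.zero_le (d ^ 2)]
  · push Not at hheavy
    have hR : R ≤ #(fibre π A (π a)) := by
      refine (le_max_left R 2).trans (hrich.trans (card_le_card fun x hx => ?_))
      obtain ⟨hxA, hxv⟩ := mem_filter.1 hx
      refine mem_fibre.2 ⟨hxA, ?_⟩
      rw [← hπ]
      exact (Submodule.Quotient.eq _).2 hxv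
    obtain ⟨X, hXA, hXc, hX⟩ := hmany V _ π f A hf hdim' ⟨π a, hR⟩ hheavy
    exact (hfew' X hXA (by omega)).not_ge hX

end MainInduction

end FewTranslates

theorem stmt_0 (d : ℕ) (hd : 1 ≤ d) :
    ∃ c : ℕ, 0 < c ∧ ∀ A : Finset (Fin d → ℝ), A.Nonempty →
      Module.finrank ℝ (affineSpan ℝ (A : Set (Fin d → ℝ))).direction = d →
      ∃ a : Fin c → (Fin d → ℝ), (∀ i, a i ∈ A) ∧
        ((d + 1 : ℤ) * A.card - 5 * (d + 1) ^ 3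
          ≤ ((A + Finset.image a Finset.univ).card : ℤ)) := by
  obtain ⟨c, hc⟩ := FewTranslates.fewTranslatesSuffice d
  refine ⟨c + 1, c.succ_pos, fun A hA hdim => ?_⟩
  rw [direction_affineSpan] at hdim
  obtain ⟨X, hXA, hXc, hX⟩ := hc (Fin d → ℝ) A hA hdim
  obtain ⟨a₀, ha₀⟩ := hA
  let a : Fin (c + 1) → Fin d → ℝ := fun i =>
    if h : i.val < X.card then (X.equivFin.symm ⟨i, h⟩ : Fin d → ℝ) else a₀
  have haX : X ⊆ Finset.image a Finset.univ := by
    intro x hx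
    have hi := (X.equivFin ⟨x, hx⟩).isLt
    refine Finset.mem_image.2 ⟨⟨X.equivFin ⟨x, hx⟩, by omega⟩, Finset.mem_univ _, ?_⟩
    simp [a]
  have hcard : (A + X).card ≤ (A + Finset.image a Finset.univ).card := by
    refine Finset.card_le_card ?_
    convert Finset.add_subset_add_left haX
  refine ⟨a, fun i => ?_, ?_⟩
  · by_cases h : i.val < X.card
    · simpa only [a, dif_pos h] using hXA (X.equivFin.symm ⟨i, h⟩).2
    · simpa only [a, dif_neg h] using ha₀
  · have h : (d + 1) * A.card ≤ (A + Finset.image a Finset.univ).card + 5 * (d + 1) ^ 3 := by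
      have hX' : (d + 1) * A.card ≤ (A + X).card + 5 * (d + 1) ^ 3 := by
        convert hX using 6
        rfl
      exact hX'.trans (Nat.add_le_add_right hcard _)
    zify at h
    linarith
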